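/- arXiv:2305.11883 — 2 statements merged into one kernel-verified Lean document; each statement's English description precedes it below -/
import Mathlib

section
/- Let 0<ρ<1, μ∈ℂ, α>0, and let (λ_k) be a nondecreasing sequence of positive reals with λ_k→∞ and λ_k≠α² for all k. Then there exist constants C₄>0 and C₅>0 such that for every t≥0, every square-summable complex sequence (g_k), and each choice of sign ∓: (i) ∑_k |α²−λ_k|^{−1} |E_{ρ,μ}(−(α∓√(α²−λ_k)) t^ρ)|² |g_k|² ≤ C₄ ∑_k |g_k|²; and (ii) ∑_k (|α∓√(α²−λ_k)|²/|α²−λ_k|) |E_{ρ,μ}(−(α∓√(α²−λ_k)) t^ρ)|² |g_k|² ≤ C₅ ∑_k |g_k|². -/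
open Filter

/-- The two-parameter Mittag-Leffler function. -/
noncomputable def mlE (ρ : ℝ) (μ : ℂ) (z : ℂ) : ℂ :=
  ∑' k : ℕ, z ^ k / Complex.Gamma (((ρ * k : ℝ) : ℂ) + μ)

/-- The principal complex square root of `α² - λ`. -/
noncomputable def sqrtD (α lam : ℝ) : ℂ := ((α ^ 2 - lam : ℝ) : ℂ) ^ ((1:ℂ)/2)

open MeasureTheory Set Topology

theorem norm_cpow_mul_exp_neg_mul {s a : ℂ} {t : ℝ} (ht : 0 < t) :
    ‖(t : ℂ) ^ s * Complex.exp (-(a * t))‖ = t ^ s.re * Real.exp (-a.re * t) := by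
  rw [norm_mul, Complex.norm_cpow_eq_rpow_re_of_pos ht, Complex.norm_exp]
  simp

theorem aestronglyMeasurable_cpow_mul_exp_neg_mul (s a : ℂ) :
    AEStronglyMeasurable (fun t : ℝ => (t : ℂ) ^ s * Complex.exp (-(a * t)))
      (volume.restrict (Ioi 0)) := by
  apply Measurable.aestronglyMeasurable
  fun_prop

theorem integrableOn_cpow_mul_exp_neg_mul {s a : ℂ} (hs : -1 < s.re) (ha : 0 < a.re) :
    IntegrableOn (fun t : ℝ => (t : ℂ) ^ s * Complex.exp (-(a * t))) (Ioi 0) := by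
  have h := integrableOn_rpow_mul_exp_neg_mul_rpow (p := 1) hs one_pos ha
  refine Integrable.mono' h (aestronglyMeasurable_cpow_mul_exp_neg_mul s a) ?_
  refine (ae_restrict_iff' measurableSet_Ioi).mpr (.of_forall fun t ht => ?_)
  rw [norm_cpow_mul_exp_neg_mul ht, Real.rpow_one]

theorem differentiableOn_integral_cpow_mul_exp_neg_mul {s : ℂ} (hs : 0 < s.re) :
    DifferentiableOn ℂ
      (fun a : ℂ => ∫ t : ℝ in Ioi 0, (t : ℂ) ^ (s - 1) * Complex.exp (-(a * t)))
      {a | 0 < a.re} := by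
  intro a ha
  have ha' : 0 < a.re := ha
  have hs1 : -1 < (s - 1).re := by simpa using hs
  refine (hasDerivAt_integral_of_dominated_loc_of_deriv_le (𝕜 := ℂ)
    (x₀ := a) (s := {x : ℂ | a.re / 2 < x.re})
    (F := fun x t => (t : ℂ) ^ (s - 1) * Complex.exp (-(x * t)))
    (F' := fun x t => -((t : ℂ) ^ s * Complex.exp (-(x * t))))
    (bound := fun t => t ^ s.re * Real.exp (-(a.re / 2) * t ^ (1 : ℝ)))
    ((isOpen_lt continuous_const Complex.continuous_re).mem_nhds
      (half_lt_self ha'))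
    (.of_forall fun x => aestronglyMeasurable_cpow_mul_exp_neg_mul _ _)
    (integrableOn_cpow_mul_exp_neg_mul hs1 ha)
    (aestronglyMeasurable_cpow_mul_exp_neg_mul _ _).neg ?_
    (integrableOn_rpow_mul_exp_neg_mul_rpow (by linarith) one_pos (by linarith))
    ?_).2.differentiableAt.differentiableWithinAt
  · refine (ae_restrict_iff' measurableSet_Ioi).mpr (.of_forall fun t (ht : 0 < t) x hx => ?_)
    rw [norm_neg, norm_cpow_mul_exp_neg_mul ht, Real.rpow_one]
    have : a.re / 2 < x.re := hx
    gcongr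
  · refine (ae_restrict_iff' measurableSet_Ioi).mpr (.of_forall fun t (ht : 0 < t) x hx => ?_)
    have ht0 : (t : ℂ) ≠ 0 := by exact_mod_cast ht.ne'
    have h := (((hasDerivAt_id x).mul_const (t : ℂ)).neg.cexp).const_mul ((t : ℂ) ^ (s - 1))
    refine h.congr_deriv ?_
    rw [Complex.cpow_sub _ _ ht0, Complex.cpow_one]
    simp only [id, Pi.neg_apply]
    field_simp

/-- The Gamma integral rescaled by a complex parameter in the right half-plane. -/
theorem integral_cpow_mul_exp_neg_mul_Ioi_complex {s a : ℂ} (hs : 0 < s.re) (ha : 0 < a.re) :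
    ∫ t : ℝ in Ioi 0, (t : ℂ) ^ (s - 1) * Complex.exp (-(a * t)) =
      a ^ (-s) * Complex.Gamma s := by
  have hopen : IsOpen {a : ℂ | 0 < a.re} := isOpen_lt continuous_const Complex.continuous_re
  refine AnalyticOnNhd.eqOn_of_preconnected_of_frequently_eq
    (f := fun a : ℂ => ∫ t : ℝ in Ioi 0, (t : ℂ) ^ (s - 1) * Complex.exp (-(a * t)))
    (g := fun a : ℂ => a ^ (-s) * Complex.Gamma s) (U := {a : ℂ | 0 < a.re}) (z₀ := 1)
    ((differentiableOn_integral_cpow_mul_exp_neg_mul hs).analyticOnNhd hopen)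
    (DifferentiableOn.analyticOnNhd (fun x hx => ?_) hopen)
    (convex_halfSpace_re_gt 0).isPreconnected (by simp) ?_ ha
  · exact ((differentiableAt_id.cpow_const (.inl hx)).mul_const _).differentiableWithinAt
  · have hlim : Tendsto (fun n : ℕ => ((1 + 1 / ((n : ℝ) + 1) : ℝ) : ℂ)) atTop (𝓝[≠] 1) := by
      refine tendsto_nhdsWithin_iff.mpr ⟨?_, .of_forall fun n => ?_⟩
      · have h := (tendsto_one_div_add_atTop_nhds_zero_nat (𝕜 := ℝ)).const_add 1
        rw [add_zero] at h
        exact_mod_cast (Complex.continuous_ofReal.tendsto 1).comp h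
      · have : (0 : ℝ) < 1 / ((n : ℝ) + 1) := by positivity
        rw [mem_compl_singleton_iff, ← Complex.ofReal_one, Ne, Complex.ofReal_inj]
        linarith
    refine hlim.frequently (.of_forall fun n => ?_)
    have hr : (0 : ℝ) < 1 + 1 / ((n : ℝ) + 1) := by positivity
    generalize 1 + 1 / ((n : ℝ) + 1) = r at hr
    rw [Complex.integral_cpow_mul_exp_neg_mul_Ioi hs hr, one_div,
      Complex.inv_cpow _ _ (by rw [Complex.arg_ofReal_of_nonneg hr.le]; exact Real.pi_pos.ne),
      Complex.cpow_neg]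

/-- The point of height `2πξ` on the vertical line of abscissa `c`. -/
noncomputable def vertLine (c ξ : ℝ) : ℂ := c + 2 * Real.pi * ξ * Complex.I

theorem vertLine_re (c ξ : ℝ) : (vertLine c ξ).re = c := by simp [vertLine]

theorem vertLine_im (c ξ : ℝ) : (vertLine c ξ).im = 2 * Real.pi * ξ := by simp [vertLine]

theorem vertLine_ne_zero {c : ℝ} (hc : 0 < c) (ξ : ℝ) : vertLine c ξ ≠ 0 := fun h => by
  have := vertLine_re c ξ
  rw [h, Complex.zero_re] at this
  linarith

theorem le_norm_vertLine (c ξ : ℝ) : c ≤ ‖vertLine c ξ‖ := by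
  simpa [vertLine_re] using Complex.re_le_norm (vertLine c ξ)

theorem continuous_vertLine (c : ℝ) : Continuous (vertLine c) := by
  unfold vertLine; fun_prop

theorem continuous_vertLine_cpow {c : ℝ} (hc : 0 < c) (s : ℂ) :
    Continuous fun ξ => vertLine c ξ ^ s :=
  (continuous_vertLine c).cpow continuous_const fun ξ => .inl (by rwa [vertLine_re])

theorem norm_vertLine_cpow_neg_le {c : ℝ} (hc : 1 ≤ c) {s : ℂ} (hs : 0 ≤ s.re) (ξ : ℝ) :
    ‖vertLine c ξ ^ (-s)‖ ≤ Real.exp (Real.pi * |s.im|) * (1 + ‖ξ‖ ^ 2) ^ (-s.re / 2) := by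
  have hne := vertLine_ne_zero (by linarith : 0 < c) ξ
  rw [Complex.norm_cpow_of_ne_zero hne, div_eq_inv_mul, ← Real.exp_neg]
  gcongr
  · calc _ ≤ |Complex.arg (vertLine c ξ) * s.im| := by
          rw [Complex.neg_im, mul_neg, neg_neg]; exact le_abs_self _
      _ ≤ _ := by
          rw [abs_mul]; gcongr; exact Complex.abs_arg_le_pi _
  · have hsq : 1 + ‖ξ‖ ^ 2 ≤ ‖vertLine c ξ‖ ^ 2 := by
      rw [← Complex.normSq_eq_norm_sq, Complex.normSq_apply, vertLine_re, vertLine_im,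
        Real.norm_eq_abs, sq_abs]
      have hpi : 1 ≤ 2 * Real.pi := by linarith [Real.pi_gt_three]
      nlinarith [mul_self_nonneg ξ, mul_le_mul hpi hpi zero_le_one (by positivity)]
    have h : ‖vertLine c ξ‖ ^ (-s).re = (‖vertLine c ξ‖ ^ 2) ^ (-s.re / 2) := by
      rw [← Real.rpow_natCast, ← Real.rpow_mul (norm_nonneg _)]
      congr 1
      simp; ring
    rw [h]
    exact Real.rpow_le_rpow_of_nonpos (by positivity) hsq (by linarith)

theorem integrable_vertLine_cpow_neg {c : ℝ} (hc : 1 ≤ c) {s : ℂ} (hs : 1 < s.re) :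
    Integrable fun ξ => vertLine c ξ ^ (-s) :=
  Integrable.mono' ((integrable_rpow_neg_one_add_norm_sq (by simpa using hs)).const_mul _)
    (continuous_vertLine_cpow (by linarith) _).aestronglyMeasurable
    (.of_forall (norm_vertLine_cpow_neg_le hc (by linarith)))

/-- The inverse Laplace transform representation of the reciprocal Gamma function. -/
theorem inv_Gamma_eq_integral_vertLine {c : ℝ} (hc : 1 ≤ c) {s : ℂ} (hs : 1 < s.re) :
    (Complex.Gamma s)⁻¹ =
      ∫ ξ : ℝ, Complex.exp (vertLine c ξ) * vertLine c ξ ^ (-s) := by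
  have hc0 : 0 < c := by linarith
  have hs1 : 0 < (s - 1).re := by simpa using hs
  have hΓ : Complex.Gamma s ≠ 0 := Complex.Gamma_ne_zero_of_re_pos (by linarith)
  set f : ℝ → ℂ := (Ioi 0).indicator
    fun t : ℝ => (t : ℂ) ^ (s - 1) * Complex.exp (-(c * t)) with hf
  have hinteg : Integrable f := (integrableOn_cpow_mul_exp_neg_mul (a := c) (by linarith)
    (by simpa using hc0)).integrable_indicator measurableSet_Ioi
  have hfour : FourierTransform.fourier f =
      fun ξ => vertLine c ξ ^ (-s) * Complex.Gamma s := by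
    ext ξ
    rw [Real.fourier_real_eq_integral_exp_smul,
      ← integral_cpow_mul_exp_neg_mul_Ioi_complex (by linarith) (by rwa [vertLine_re]),
      ← integral_indicator measurableSet_Ioi]
    congr 1 with t
    by_cases ht : t ∈ Ioi (0 : ℝ)
    · simp only [hf, indicator_of_mem ht, smul_eq_mul, vertLine]
      rw [mul_left_comm, ← Complex.exp_add]
      congr 2
      push_cast
      ring
    · simp [hf, indicator_of_notMem ht]
  have hcont : ContinuousAt f 1 := by
    have h : ContinuousAt (fun t : ℝ => (t : ℂ) ^ (s - 1) * Complex.exp (-(c * t))) 1 :=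
      (Complex.continuous_ofReal.continuousAt.cpow continuousAt_const (by simp)).mul
        (by fun_prop)
    refine h.congr ?_
    filter_upwards [Ioi_mem_nhds (zero_lt_one' ℝ)] with t ht
    simp only [hf, indicator_of_mem ht]
  have hinv := hinteg.fourierInv_fourier_eq
    (by rw [hfour]; exact (integrable_vertLine_cpow_neg hc hs).mul_const _) hcont
  rw [Real.fourierInv_eq', hfour] at hinv
  have h1 : f 1 = Complex.exp (-c) := by simp [hf]
  rw [h1] at hinv
  rw [inv_eq_iff_eq_inv, eq_comm, inv_eq_iff_eq_inv, ← one_div, eq_div_iff hΓ,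
    ← integral_mul_const]
  have h2 : Complex.exp c * Complex.exp (-c) = 1 := by
    rw [← Complex.exp_add]; simp
  rw [← h2, ← hinv, ← integral_const_mul]
  congr 1 with ξ
  simp only [vertLine, Complex.exp_add, smul_eq_mul]
  rw [show ((2 * Real.pi * inner ℝ ξ (1 : ℝ) : ℝ) : ℂ) * Complex.I
    = 2 * Real.pi * ξ * Complex.I by simp]
  ring

theorem norm_inv_vertLine_cpow_le {ρ c : ℝ} (hρ : 0 ≤ ρ) (hc : 0 < c) (ξ : ℝ) :
    ‖(vertLine c ξ ^ (ρ : ℂ))⁻¹‖ ≤ (c ^ ρ)⁻¹ := by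
  rw [norm_inv, Complex.norm_cpow_real]
  have := le_norm_vertLine c ξ
  gcongr

theorem vertLine_cpow_neg_add {ρ c : ℝ} (hc : 0 < c) (μ : ℂ) (k : ℕ) (ξ : ℝ) :
    vertLine c ξ ^ (-(((ρ * k : ℝ) : ℂ) + μ)) =
      vertLine c ξ ^ (-μ) * ((vertLine c ξ ^ (ρ : ℂ))⁻¹) ^ k := by
  rw [neg_add_rev, Complex.cpow_add _ _ (vertLine_ne_zero hc ξ),
    Complex.cpow_neg _ ((ρ * k : ℝ) : ℂ), inv_pow, ← Complex.cpow_mul_nat]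
  push_cast
  rfl

theorem integrable_exp_mul_vertLine_cpow {c : ℝ} (hc : 1 ≤ c) {μ : ℂ} (hμ : 1 < μ.re) :
    Integrable fun ξ => Complex.exp (vertLine c ξ) * vertLine c ξ ^ (-μ) := by
  refine (integrable_vertLine_cpow_neg hc hμ).bdd_mul (c := Real.exp c)
    (Complex.continuous_exp.comp (continuous_vertLine c)).aestronglyMeasurable
    (.of_forall fun ξ => ?_)
  simp [Complex.norm_exp, vertLine_re]

theorem norm_exp_mul_vertLine_cpow_neg_add_le {ρ c : ℝ} (hρ : 0 ≤ ρ) (hc : 0 < c) (μ : ℂ) (k : ℕ)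
    (ξ : ℝ) :
    ‖Complex.exp (vertLine c ξ) * vertLine c ξ ^ (-(((ρ * k : ℝ) : ℂ) + μ))‖ ≤
      ‖Complex.exp (vertLine c ξ) * vertLine c ξ ^ (-μ)‖ * ((c ^ ρ)⁻¹) ^ k := by
  rw [vertLine_cpow_neg_add hc, ← mul_assoc, norm_mul _ (_ ^ k), norm_pow]
  gcongr
  exact norm_inv_vertLine_cpow_le hρ hc ξ

theorem one_lt_re_ofReal_mul_add {ρ : ℝ} (hρ : 0 ≤ ρ) {μ : ℂ} (hμ : 1 < μ.re) (k : ℕ) :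
    1 < (((ρ * k : ℝ) : ℂ) + μ).re := by
  have : 0 ≤ ρ * k := by positivity
  rw [Complex.add_re, Complex.ofReal_re]
  linarith

/-- The Mittag-Leffler coefficients decay faster than every geometric sequence. -/
theorem exists_norm_inv_Gamma_le_of_one_lt_re {ρ : ℝ} (hρ : 0 < ρ) {μ : ℂ} (hμ : 1 < μ.re)
    {r : ℝ} (hr : 0 < r) :
    ∃ C, ∀ k : ℕ, ‖(Complex.Gamma (((ρ * k : ℝ) : ℂ) + μ))⁻¹‖ ≤ C * r ^ k := by
  obtain ⟨c, hc, hcr⟩ : ∃ c : ℝ, 1 ≤ c ∧ r⁻¹ ≤ c ^ ρ :=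
    ((eventually_ge_atTop 1).and ((tendsto_rpow_atTop hρ).eventually_ge_atTop r⁻¹)).exists
  have hc0 : 0 < c := by linarith
  refine ⟨∫ ξ, ‖Complex.exp (vertLine c ξ) * vertLine c ξ ^ (-μ)‖, fun k => ?_⟩
  rw [inv_Gamma_eq_integral_vertLine hc (one_lt_re_ofReal_mul_add hρ.le hμ k),
    ← integral_mul_const]
  refine (norm_integral_le_integral_norm _).trans (integral_mono
    (integrable_exp_mul_vertLine_cpow hc (one_lt_re_ofReal_mul_add hρ.le hμ k)).norm
    ((integrable_exp_mul_vertLine_cpow hc hμ).norm.mul_const _) fun ξ => ?_)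
  refine (norm_exp_mul_vertLine_cpow_neg_add_le hρ.le hc0 μ k ξ).trans ?_
  gcongr
  exact inv_le_of_inv_le₀ hr hcr

theorem inv_Gamma_add_sub_one (ρ : ℝ) (μ : ℂ) (k : ℕ) :
    (Complex.Gamma (((ρ * k : ℝ) : ℂ) + (μ - 1)))⁻¹ =
      (ρ * k + (μ - 1)) * (Complex.Gamma (((ρ * k : ℝ) : ℂ) + μ))⁻¹ := by
  rw [Complex.one_div_Gamma_eq_self_mul_one_div_Gamma_add_one]
  push_cast
  ring_nf

/-- Induction on the second parameter, downwards from the half-plane `1 < re μ`. -/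
theorem forall_of_one_lt_re {P : ℂ → Prop} (h1 : ∀ μ : ℂ, 1 < μ.re → P μ)
    (hstep : ∀ μ : ℂ, P μ → P (μ - 1)) (μ : ℂ) : P μ := by
  have h : ∀ n : ℕ, ∀ μ : ℂ, 1 < μ.re + n → P μ := by
    intro n
    induction n with
    | zero => intro μ hμ; exact h1 μ (by simpa using hμ)
    | succ n ih =>
      intro μ hμ
      have := hstep (μ + 1) (ih (μ + 1) (by
        push_cast at hμ
        rw [Complex.add_re, Complex.one_re]
        linarith))
      rwa [add_sub_cancel_right] at this
  obtain ⟨n, hn⟩ := exists_nat_gt (1 - μ.re)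
  exact h n μ (by linarith)

theorem exists_norm_inv_Gamma_le {ρ : ℝ} (hρ : 0 < ρ) (μ : ℂ) :
    ∀ r : ℝ, 0 < r →
      ∃ C, ∀ k : ℕ, ‖(Complex.Gamma (((ρ * k : ℝ) : ℂ) + μ))⁻¹‖ ≤ C * r ^ k := by
  refine forall_of_one_lt_re (P := fun μ => ∀ r : ℝ, 0 < r →
    ∃ C, ∀ k : ℕ, ‖(Complex.Gamma (((ρ * k : ℝ) : ℂ) + μ))⁻¹‖ ≤ C * r ^ k)
    (fun μ hμ r => exists_norm_inv_Gamma_le_of_one_lt_re hρ hμ) ?_ μ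
  intro μ ih r hr
  obtain ⟨C, hC⟩ := ih (r / 2) (by positivity)
  refine ⟨(ρ + ‖μ - 1‖) * C, fun k => ?_⟩
  rw [inv_Gamma_add_sub_one, norm_mul]
  have h1 : ‖(ρ * k + (μ - 1) : ℂ)‖ ≤ (ρ + ‖μ - 1‖) * 2 ^ k := by
    have hk : (k : ℝ) ≤ 2 ^ k := by exact_mod_cast (Nat.lt_two_pow_self (n := k)).le
    have hk1 : (1 : ℝ) ≤ 2 ^ k := one_le_pow₀ one_le_two
    calc ‖(ρ * k + (μ - 1) : ℂ)‖ ≤ ‖(ρ * k : ℂ)‖ + ‖μ - 1‖ := norm_add_le _ _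
      _ = ρ * k + ‖μ - 1‖ * 1 := by simp [abs_of_pos hρ]
      _ ≤ ρ * 2 ^ k + ‖μ - 1‖ * 2 ^ k := by gcongr
      _ = _ := by ring
  calc _ ≤ (ρ + ‖μ - 1‖) * 2 ^ k * (C * (r / 2) ^ k) := by
        gcongr
        exact hC k
    _ = _ := by rw [div_pow]; field_simp

theorem exists_summable_bound_mlE {ρ : ℝ} (hρ : 0 < ρ) (μ : ℂ) {R : ℝ} (hR : 0 < R) :
    ∃ u : ℕ → ℝ, Summable u ∧ ∀ k : ℕ, ∀ z ∈ Metric.ball (0 : ℂ) R,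
      ‖z ^ k / Complex.Gamma (((ρ * k : ℝ) : ℂ) + μ)‖ ≤ u k := by
  obtain ⟨C, hC⟩ := exists_norm_inv_Gamma_le hρ μ (2 * R)⁻¹ (by positivity)
  refine ⟨fun k => C * (1 / 2) ^ k, summable_geometric_two.mul_left C, fun k z hz => ?_⟩
  have hz' : ‖z‖ ≤ R := by simpa using (mem_ball_zero_iff.mp hz).le
  rw [div_eq_mul_inv, norm_mul, norm_pow]
  calc _ ≤ R ^ k * (C * (2 * R)⁻¹ ^ k) := by
        gcongr
        exact hC k
    _ = C * (1 / 2) ^ k := by rw [inv_pow, mul_pow, one_div, inv_pow]; field_simp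

theorem hasSum_mlE {ρ : ℝ} (hρ : 0 < ρ) (μ z : ℂ) :
    HasSum (fun k : ℕ => z ^ k / Complex.Gamma (((ρ * k : ℝ) : ℂ) + μ)) (mlE ρ μ z) := by
  obtain ⟨u, hu, hle⟩ := exists_summable_bound_mlE hρ μ (R := ‖z‖ + 1) (by positivity)
  exact (Summable.of_norm_bounded hu fun k => hle k z (by simp)).hasSum

theorem differentiable_mlE {ρ : ℝ} (hρ : 0 < ρ) (μ : ℂ) : Differentiable ℂ (mlE ρ μ) := by
  intro z
  obtain ⟨u, hu, hle⟩ := exists_summable_bound_mlE hρ μ (R := ‖z‖ + 1) (by positivity)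
  exact (Complex.differentiableOn_tsum_of_summable_norm hu (fun k => by fun_prop)
    Metric.isOpen_ball hle).differentiableAt (Metric.isOpen_ball.mem_nhds (by simp))

theorem hasSum_deriv_mlE {ρ : ℝ} (hρ : 0 < ρ) (μ z : ℂ) :
    HasSum (fun k : ℕ => k * z ^ (k - 1) / Complex.Gamma (((ρ * k : ℝ) : ℂ) + μ))
      (deriv (mlE ρ μ) z) := by
  obtain ⟨u, hu, hle⟩ := exists_summable_bound_mlE hρ μ (R := ‖z‖ + 1) (by positivity)
  have h := Complex.hasSum_deriv_of_summable_norm (z := z) hu (fun k => by fun_prop)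
    Metric.isOpen_ball hle (by simp)
  simpa [funext fun z => (mlE.eq_1 ρ μ z)] using h

/-- Lowering the second parameter by one amounts to a first-order differential operator. -/
theorem mlE_sub_one {ρ : ℝ} (hρ : 0 < ρ) (μ z : ℂ) :
    mlE ρ (μ - 1) z = ρ * (z * deriv (mlE ρ μ) z) + (μ - 1) * mlE ρ μ z := by
  refine (hasSum_mlE hρ (μ - 1) z).unique ?_
  convert! (((hasSum_deriv_mlE hρ μ z).mul_left z).mul_left (ρ : ℂ)).add
    ((hasSum_mlE hρ μ z).mul_left (μ - 1)) using 2 with k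
  rw [div_eq_mul_inv, inv_Gamma_add_sub_one]
  rcases k with _ | k
  · simp
  · rw [Nat.add_sub_cancel]; ring

theorem integrable_mul_inv_one_sub_mul {h q : ℝ → ℂ} (hh : Integrable h)
    (hq : Continuous q) {d : ℝ} (hd : 0 < d) {z : ℂ} (hz : ∀ ξ, d ≤ ‖1 - z * q ξ‖) :
    Integrable fun ξ => h ξ * (1 - z * q ξ)⁻¹ := by
  refine hh.mul_bdd (c := d⁻¹) (Measurable.aestronglyMeasurable ?_) (.of_forall fun ξ => ?_)
  · have := hq.measurable
    fun_prop
  · rw [norm_inv]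
    have := hz ξ
    gcongr

theorem norm_integral_mul_inv_one_sub_mul_le {h q : ℝ → ℂ} (hh : Integrable h)
    {d : ℝ} (hd : 0 < d) {z : ℂ} (hz : ∀ ξ, d ≤ ‖1 - z * q ξ‖) :
    ‖∫ ξ, h ξ * (1 - z * q ξ)⁻¹‖ ≤ (∫ ξ, ‖h ξ‖) * d⁻¹ := by
  rw [← integral_mul_const]
  refine norm_integral_le_of_norm_le (hh.norm.mul_const _) (.of_forall fun ξ => ?_)
  rw [norm_mul, norm_inv]
  have := hz ξ
  gcongr

theorem differentiableOn_integral_mul_inv_one_sub_mul {h q : ℝ → ℂ} (hh : Integrable h)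
    (hq : Continuous q) (hq1 : ∀ ξ, ‖q ξ‖ ≤ 1) {U : Set ℂ} (hU : IsOpen U) {d : ℝ} (hd : 0 < d)
    (hz : ∀ z ∈ U, ∀ ξ, d ≤ ‖1 - z * q ξ‖) :
    DifferentiableOn ℂ (fun z => ∫ ξ, h ξ * (1 - z * q ξ)⁻¹) U := by
  intro z hzU
  have hqm := hq.measurable
  refine (hasDerivAt_integral_of_dominated_loc_of_deriv_le (𝕜 := ℂ) (x₀ := z) (s := U)
    (F := fun z ξ => h ξ * (1 - z * q ξ)⁻¹)
    (F' := fun z ξ => h ξ * (q ξ / (1 - z * q ξ) ^ 2))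
    (bound := fun ξ => ‖h ξ‖ * (1 / d ^ 2)) (hU.mem_nhds hzU)
    (.of_forall fun x => hh.aestronglyMeasurable.mul
      (Measurable.aestronglyMeasurable (by fun_prop)))
    (integrable_mul_inv_one_sub_mul hh hq hd (hz z hzU))
    (hh.aestronglyMeasurable.mul (Measurable.aestronglyMeasurable (by fun_prop)))
    (.of_forall fun ξ x hx => ?_) (hh.norm.mul_const _)
    (.of_forall fun ξ x hx => ?_)).2.differentiableAt.differentiableWithinAt
  · rw [norm_mul, norm_div, norm_pow]
    have h1 := hz x hx ξ
    have h2 := hq1 ξ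
    gcongr
  · have hne : 1 - x * q ξ ≠ 0 := norm_pos_iff.mp (hd.trans_le (hz x hx ξ))
    have := ((((hasDerivAt_id x).mul_const (q ξ)).const_sub 1).inv hne).const_mul (h ξ)
    exact this.congr_deriv (by simp)

theorem hasSum_integral_mul_inv_one_sub_mul {h q : ℝ → ℂ} (hh : Integrable h)
    (hq : Continuous q) (hq1 : ∀ ξ, ‖q ξ‖ ≤ 1) {z : ℂ} (hz : ‖z‖ < 1) :
    HasSum (fun k : ℕ => z ^ k * ∫ ξ, h ξ * q ξ ^ k) (∫ ξ, h ξ * (1 - z * q ξ)⁻¹) := by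
  have hle : ∀ (k : ℕ) ξ, ‖(z * q ξ) ^ k‖ ≤ ‖z‖ ^ k := fun k ξ => by
    rw [norm_pow, norm_mul]
    gcongr
    exact mul_le_of_le_one_right (norm_nonneg _) (hq1 ξ)
  have hinteg : ∀ k : ℕ, Integrable fun ξ => h ξ * (z * q ξ) ^ k := fun k =>
    hh.mul_bdd (by fun_prop) (.of_forall (hle k))
  have hsum : Summable fun k : ℕ => ∫ ξ, ‖h ξ * (z * q ξ) ^ k‖ := by
    refine Summable.of_nonneg_of_le (fun k => integral_nonneg fun ξ => norm_nonneg _)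
      (fun k => ?_) ((summable_geometric_of_lt_one (norm_nonneg z) hz).mul_left (∫ ξ, ‖h ξ‖))
    rw [← integral_mul_const]
    refine integral_mono (hinteg k).norm (hh.norm.mul_const _) fun ξ => ?_
    dsimp only
    rw [norm_mul]
    gcongr
    exact hle k ξ
  convert! hasSum_integral_of_summable_integral_norm hinteg hsum using 2 with k
  · rw [← integral_const_mul]
    congr 1 with ξ
    ring
  · ext ξ
    rw [tsum_mul_left, tsum_geometric_of_norm_lt_one]
    simpa using (hle 1 ξ).trans_lt (by simpa using hz)

/-- An open neighbourhood of the closed left half-plane, of conical shape at infinity. -/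
def leftCone (ε : ℝ) : Set ℂ := {z | z.re < ε * (‖z‖ + 1)}

theorem mem_leftCone {ε : ℝ} {z : ℂ} : z ∈ leftCone ε ↔ z.re < ε * (‖z‖ + 1) := Iff.rfl

theorem mem_leftCone_of_re_nonpos {ε : ℝ} (hε : 0 < ε) {z : ℂ} (hz : z.re ≤ 0) :
    z ∈ leftCone ε :=
  lt_of_le_of_lt hz (by positivity)

theorem isOpen_leftCone (ε : ℝ) : IsOpen (leftCone ε) :=
  isOpen_lt Complex.continuous_re (by fun_prop)

theorem isPreconnected_leftCone {ε : ℝ} (hε : 0 < ε) : IsPreconnected (leftCone ε) := by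
  have h0 : (0 : ℂ) ∈ leftCone ε := mem_leftCone_of_re_nonpos hε (by simp)
  refine (StarConvex.isPathConnected (a := 0) ?_ h0).isConnected.isPreconnected
  rw [starConvex_zero_iff]
  intro z hz a ha0 ha1
  rw [mem_leftCone] at hz ⊢
  rw [Complex.smul_re, norm_smul, Real.norm_eq_abs, abs_of_nonneg ha0, smul_eq_mul]
  rcases ha0.eq_or_lt with rfl | ha
  · simpa using hε
  · nlinarith [mul_lt_mul_of_pos_left hz ha]

theorem le_norm_one_sub_mul_inv {c₀ ε : ℝ} (hε : 0 < ε) {p z : ℂ} (hp1 : 1 ≤ ‖p‖)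
    (hp : c₀ * ‖p‖ ≤ p.re) (hz : z ∈ leftCone ε) :
    (c₀ - 2 * ε) / (1 + ε) ≤ ‖1 - z * p⁻¹‖ := by
  have hp0 : p ≠ 0 := norm_pos_iff.mp (by linarith)
  have h1 : p.re - z.re ≤ ‖p - z‖ := by simpa using Complex.re_le_norm (p - z)
  have h2 : ‖z‖ ≤ ‖p‖ + ‖p - z‖ := by
    simpa [add_comm] using norm_le_norm_add_norm_sub' z p |>.trans_eq (by rw [norm_sub_rev])
  rw [mem_leftCone] at hz
  have h3 : 1 - z * p⁻¹ = (p - z) / p := by field_simp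
  rw [h3, norm_div, div_le_div_iff₀ (by positivity) (by linarith)]
  nlinarith [mul_le_mul_of_nonneg_left h2 hε.le, mul_le_mul_of_nonneg_left hp1 hε.le]

theorem mul_norm_vertLine_cpow_le_re {ρ c : ℝ} (hρ : 0 ≤ ρ) (hρ1 : ρ ≤ 1) (hc : 0 < c) (ξ : ℝ) :
    Real.cos (ρ * (Real.pi / 2)) * ‖vertLine c ξ ^ (ρ : ℂ)‖ ≤ (vertLine c ξ ^ (ρ : ℂ)).re := by
  have hne := vertLine_ne_zero hc ξ
  have harg : |Complex.arg (vertLine c ξ)| ≤ Real.pi / 2 :=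
    Complex.abs_arg_le_pi_div_two_iff.mpr (by rw [vertLine_re]; exact hc.le)
  rw [Complex.cpow_ofReal_re, Complex.norm_cpow_real, mul_comm]
  gcongr
  rw [← Real.cos_abs (_ * ρ), abs_mul, abs_of_nonneg hρ, mul_comm |_|]
  refine Real.cos_le_cos_of_nonneg_of_le_pi (by positivity) ?_ (by gcongr)
  nlinarith [Real.pi_pos]

theorem exists_norm_mlE_le_of_one_lt_re {ρ : ℝ} (hρ : 0 < ρ) (hρ1 : ρ < 1) {μ : ℂ}
    (hμ : 1 < μ.re) :
    ∃ ε : ℝ, 0 < ε ∧ ∃ C, ∀ z ∈ leftCone ε, ‖mlE ρ μ z‖ ≤ C := by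
  set c₀ := Real.cos (ρ * (Real.pi / 2)) with hc₀
  have hc₀pos : 0 < c₀ := Real.cos_pos_of_mem_Ioo
    ⟨by nlinarith [Real.pi_pos, mul_pos hρ Real.pi_pos], by nlinarith [Real.pi_pos]⟩
  set ε := c₀ / 4 with hε
  have hεpos : 0 < ε := by positivity
  set d := (c₀ - 2 * ε) / (1 + ε) with hd
  have hdpos : 0 < d := div_pos (by linarith) (by linarith)
  set h : ℝ → ℂ := fun ξ => Complex.exp (vertLine 1 ξ) * vertLine 1 ξ ^ (-μ) with hh_def
  set q : ℝ → ℂ := fun ξ => (vertLine 1 ξ ^ (ρ : ℂ))⁻¹ with hq_def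
  have hh : Integrable h := integrable_exp_mul_vertLine_cpow le_rfl hμ
  have hp1 : ∀ ξ, 1 ≤ ‖vertLine 1 ξ ^ (ρ : ℂ)‖ := fun ξ => by
    rw [Complex.norm_cpow_real]
    exact Real.one_le_rpow (le_norm_vertLine 1 ξ) hρ.le
  have hq : Continuous q := (continuous_vertLine_cpow one_pos _).inv₀ fun ξ =>
    norm_pos_iff.mp (one_pos.trans_le (hp1 ξ))
  have hq1 : ∀ ξ, ‖q ξ‖ ≤ 1 := fun ξ => by
    rw [norm_inv]; exact inv_le_one_of_one_le₀ (hp1 ξ)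
  have hlow : ∀ z ∈ leftCone ε, ∀ ξ, d ≤ ‖1 - z * q ξ‖ := fun z hz ξ =>
    le_norm_one_sub_mul_inv hεpos (hp1 ξ)
      (mul_norm_vertLine_cpow_le_re hρ.le hρ1.le one_pos ξ) hz
  have hsmall : ∀ z : ℂ, ‖z‖ < 1 → mlE ρ μ z = ∫ ξ, h ξ * (1 - z * q ξ)⁻¹ := fun z hz => by
    refine (hasSum_mlE hρ μ z).unique ?_
    convert! hasSum_integral_mul_inv_one_sub_mul hh hq hq1 hz using 2 with k
    rw [div_eq_mul_inv,
      inv_Gamma_eq_integral_vertLine le_rfl (one_lt_re_ofReal_mul_add hρ.le hμ k)]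
    congr 2 with ξ
    rw [vertLine_cpow_neg_add one_pos, ← mul_assoc]
  have heq : EqOn (mlE ρ μ) (fun z => ∫ ξ, h ξ * (1 - z * q ξ)⁻¹) (leftCone ε) := by
    refine AnalyticOnNhd.eqOn_of_preconnected_of_eventuallyEq (z₀ := 0)
      ((differentiable_mlE hρ μ).differentiableOn.analyticOnNhd (isOpen_leftCone ε))
      ((differentiableOn_integral_mul_inv_one_sub_mul hh hq hq1 (isOpen_leftCone ε) hdpos
        hlow).analyticOnNhd (isOpen_leftCone ε))
      (isPreconnected_leftCone hεpos) (mem_leftCone_of_re_nonpos hεpos (by simp)) ?_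
    filter_upwards [Metric.ball_mem_nhds (0 : ℂ) one_pos] with z hz
    exact hsmall z (by simpa using hz)
  refine ⟨ε, hεpos, (∫ ξ, ‖h ξ‖) * d⁻¹, fun z hz => ?_⟩
  rw [heq hz]
  exact norm_integral_mul_inv_one_sub_mul_le hh hdpos (hlow z hz)

theorem closedBall_subset_leftCone {ε : ℝ} (hε : 0 < ε) (hε1 : ε ≤ 1 / 2) {z : ℂ}
    (hz : z ∈ leftCone ε) :
    Metric.closedBall z (ε * (‖z‖ + 1)) ⊆ leftCone (4 * ε) := by
  intro w hw
  rw [mem_closedBall_iff_norm] at hw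
  rw [mem_leftCone] at hz ⊢
  have h1 : w.re - z.re ≤ ‖w - z‖ := by simpa using Complex.re_le_norm (w - z)
  have h2 : ‖z‖ ≤ ‖w‖ + ‖w - z‖ := by
    simpa [add_comm] using norm_le_norm_add_norm_sub' z w |>.trans_eq (by rw [norm_sub_rev])
  have h3 : ε * (‖z‖ + 1) ≤ 1 / 2 * (‖z‖ + 1) := by gcongr
  have h4 : ‖z‖ + 1 ≤ 2 * (‖w‖ + 1) := by linarith
  nlinarith [mul_le_mul_of_nonneg_left h4 hε.le]

/-- For `0 < ρ < 1` the Mittag-Leffler function is bounded on a neighbourhood of the closed left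
half-plane that is conical at infinity. -/
theorem exists_norm_mlE_le {ρ : ℝ} (hρ : 0 < ρ) (hρ1 : ρ < 1) (μ : ℂ) :
    ∃ ε : ℝ, 0 < ε ∧ ∃ C, ∀ z ∈ leftCone ε, ‖mlE ρ μ z‖ ≤ C := by
  refine forall_of_one_lt_re
    (P := fun μ => ∃ ε : ℝ, 0 < ε ∧ ∃ C, ∀ z ∈ leftCone ε, ‖mlE ρ μ z‖ ≤ C)
    (fun μ hμ => exists_norm_mlE_le_of_one_lt_re hρ hρ1 hμ) ?_ μ
  rintro μ ⟨ε, hε, C, hC⟩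
  obtain ⟨δ, hδ, hδ1, hδε⟩ : ∃ δ : ℝ, 0 < δ ∧ δ ≤ 1 / 2 ∧ 4 * δ ≤ ε :=
    ⟨min (1 / 2) (ε / 4), by positivity, min_le_left _ _, by
      linarith [min_le_right (1 / 2) (ε / 4)]⟩
  have hmono : ∀ z ∈ leftCone (4 * δ), ‖mlE ρ μ z‖ ≤ C := fun z hz =>
    hC z (lt_of_lt_of_le hz (mul_le_mul_of_nonneg_right hδε (by positivity)))
  refine ⟨δ, hδ, ρ * (C / δ) + ‖μ - 1‖ * C, fun z hz => ?_⟩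
  have hball := closedBall_subset_leftCone hδ hδ1 hz
  have hRpos : 0 < δ * (‖z‖ + 1) := by positivity
  have hCz := hmono z (hball (Metric.mem_closedBall_self hRpos.le))
  have hC0 : 0 ≤ C := (norm_nonneg _).trans hCz
  have hderiv : ‖deriv (mlE ρ μ) z‖ ≤ C / (δ * (‖z‖ + 1)) :=
    Complex.norm_deriv_le_of_forall_mem_sphere_norm_le hRpos
      (differentiable_mlE hρ μ).diffContOnCl
      fun w hw => hmono w (hball (Metric.sphere_subset_closedBall hw))
  have hzderiv : ‖z * deriv (mlE ρ μ) z‖ ≤ C / δ := by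
    rw [norm_mul]
    calc _ ≤ (‖z‖ + 1) * (C / (δ * (‖z‖ + 1))) := by gcongr; linarith
      _ = C / δ := by field_simp
  rw [mlE_sub_one hρ]
  refine (norm_add_le _ _).trans ?_
  rw [norm_mul (ρ : ℂ), norm_mul (μ - 1), Complex.norm_real, Real.norm_eq_abs, abs_of_pos hρ]
  gcongr

theorem sqrtD_sq (α l : ℝ) : sqrtD α l ^ 2 = ((α ^ 2 - l : ℝ) : ℂ) := by
  simp [sqrtD, one_div]

theorem norm_sqrtD_sq (α l : ℝ) : ‖sqrtD α l‖ ^ 2 = |α ^ 2 - l| := by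
  rw [← norm_pow, sqrtD_sq, Complex.norm_real, Real.norm_eq_abs]

theorem abs_re_sqrtD_le {α l : ℝ} (hα : 0 ≤ α) (hl : 0 ≤ l) : |(sqrtD α l).re| ≤ α := by
  have h := sqrtD_sq α l
  have hre := congrArg Complex.re h
  have him := congrArg Complex.im h
  rw [sq, Complex.mul_re, Complex.ofReal_re] at hre
  rw [sq, Complex.mul_im, Complex.ofReal_im] at him
  refine abs_le_of_sq_le_sq ?_ hα
  rcases mul_eq_zero.mp (by linarith : (sqrtD α l).re * (sqrtD α l).im = 0) with h0 | h0
  · rw [h0]; nlinarith [sq_nonneg α]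
  · rw [h0] at hre; nlinarith

theorem re_add_mul_sqrtD_nonneg {α l : ℝ} (hα : 0 ≤ α) (hl : 0 ≤ l) {σ : ℂ}
    (hσ : σ = 1 ∨ σ = -1) : 0 ≤ ((α : ℂ) + σ * sqrtD α l).re := by
  have h := abs_le.mp (abs_re_sqrtD_le hα hl)
  rcases hσ with rfl | rfl
  · simp; linarith
  · simp; linarith

theorem norm_add_mul_sqrtD_sq_le (α l : ℝ) {σ : ℂ} (hσ : σ = 1 ∨ σ = -1) :
    ‖(α : ℂ) + σ * sqrtD α l‖ ^ 2 ≤ 2 * α ^ 2 + 2 * |α ^ 2 - l| := by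
  have hσ1 : ‖σ‖ = 1 := by rcases hσ with rfl | rfl <;> simp
  have h : ‖(α : ℂ) + σ * sqrtD α l‖ ≤ |α| + ‖sqrtD α l‖ := by
    simpa [hσ1] using norm_add_le (α : ℂ) (σ * sqrtD α l)
  rw [← norm_sqrtD_sq, ← sq_abs α]
  nlinarith [norm_nonneg ((α : ℂ) + σ * sqrtD α l), sq_nonneg (|α| - ‖sqrtD α l‖)]

theorem tsum_mul_le_mul_tsum {a b : ℕ → ℝ} {C : ℝ} (ha : ∀ k, 0 ≤ a k) (haC : ∀ k, a k ≤ C)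
    (hb : ∀ k, 0 ≤ b k) (hsum : Summable b) : ∑' k, a k * b k ≤ C * ∑' k, b k := by
  have hle : ∀ k, a k * b k ≤ C * b k := fun k => mul_le_mul_of_nonneg_right (haC k) (hb k)
  rw [← tsum_mul_left]
  exact (Summable.of_nonneg_of_le (fun k => mul_nonneg (ha k) (hb k)) hle
    (hsum.mul_left C)).tsum_le_tsum hle (hsum.mul_left C)

theorem exists_abs_sub_inv_le {lam : ℕ → ℝ} (h : Tendsto lam atTop atTop) (x : ℝ) :
    ∃ B > 0, ∀ k, |x - lam k|⁻¹ ≤ B := by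
  have hlim : Tendsto (fun k => |x - lam k|⁻¹) atTop (𝓝 0) :=
    (tendsto_abs_atBot_atTop.comp (tendsto_const_nhds.add_atBot
      (tendsto_neg_atTop_atBot.comp h))).inv_tendsto_atTop
  obtain ⟨B, hB⟩ := hlim.bddAbove_range
  exact ⟨max B 1, by positivity, fun k => (hB ⟨k, rfl⟩).trans (le_max_left _ _)⟩

/-- Spectral estimates with the resolvent-type weight
`|α²-λₖ|^{-1}`. -/
theorem spectral_estimate_resolvent
    (ρ : ℝ) (hρ0 : 0 < ρ) (hρ1 : ρ < 1) (μ : ℂ) (α : ℝ) (hα : 0 < α)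
    (lam : ℕ → ℝ) (hlam_pos : ∀ k, 0 < lam k) (hlam_mono : Monotone lam)
    (hlam_tend : Tendsto lam atTop atTop) (hlam_ne : ∀ k, lam k ≠ α ^ 2) :
    ∃ C₄ > (0:ℝ), ∃ C₅ > (0:ℝ),
      ∀ t : ℝ, 0 ≤ t → ∀ g : ℕ → ℂ, Summable (fun k => ‖g k‖ ^ 2) →
        ∀ σ : ℂ, (σ = 1 ∨ σ = -1) →
          (∑' k, |α ^ 2 - lam k|⁻¹ *
              ‖mlE ρ μ (-(((α : ℂ) + σ * sqrtD α (lam k))) * ((t ^ ρ : ℝ) : ℂ))‖ ^ 2 *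
              ‖g k‖ ^ 2) ≤ C₄ * (∑' k, ‖g k‖ ^ 2) ∧
          (∑' k, (‖(α : ℂ) + σ * sqrtD α (lam k)‖ ^ 2 / |α ^ 2 - lam k|) *
              ‖mlE ρ μ (-(((α : ℂ) + σ * sqrtD α (lam k))) * ((t ^ ρ : ℝ) : ℂ))‖ ^ 2 *
              ‖g k‖ ^ 2) ≤ C₅ * (∑' k, ‖g k‖ ^ 2) := by
  obtain ⟨ε, hε, M, hM⟩ := exists_norm_mlE_le hρ0 hρ1 μ
  obtain ⟨B, hB0, hB⟩ := exists_abs_sub_inv_le hlam_tend (α ^ 2)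
  have hE : ∀ t : ℝ, 0 ≤ t → ∀ σ : ℂ, (σ = 1 ∨ σ = -1) → ∀ k,
      ‖mlE ρ μ (-(((α : ℂ) + σ * sqrtD α (lam k))) * ((t ^ ρ : ℝ) : ℂ))‖ ^ 2 ≤ M ^ 2 := by
    intro t ht σ hσ k
    have hre := re_add_mul_sqrtD_nonneg hα.le (hlam_pos k).le hσ
    have := hM _ (mem_leftCone_of_re_nonpos hε
      (z := -(((α : ℂ) + σ * sqrtD α (lam k))) * ((t ^ ρ : ℝ) : ℂ)) (by
        rw [Complex.re_mul_ofReal, Complex.neg_re]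
        exact mul_nonpos_of_nonpos_of_nonneg (by linarith) (Real.rpow_nonneg ht ρ)))
    gcongr
  refine ⟨B * M ^ 2 + 1, by positivity, (2 * α ^ 2 * B + 2) * M ^ 2 + 1, by positivity,
    fun t ht g hg σ hσ => ⟨?_, ?_⟩⟩
  · refine tsum_mul_le_mul_tsum (fun k => by positivity) (fun k => ?_)
      (fun k => by positivity) hg
    have := mul_le_mul (hB k) (hE t ht σ hσ k) (by positivity) hB0.le
    linarith
  · refine tsum_mul_le_mul_tsum (fun k => by positivity) (fun k => ?_)
      (fun k => by positivity) hg
    have hD : 0 < |α ^ 2 - lam k| := abs_pos.mpr (sub_ne_zero.mpr (hlam_ne k).symm)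
    have hw : ‖(α : ℂ) + σ * sqrtD α (lam k)‖ ^ 2 / |α ^ 2 - lam k| ≤ 2 * α ^ 2 * B + 2 := by
      calc _ ≤ (2 * α ^ 2 + 2 * |α ^ 2 - lam k|) / |α ^ 2 - lam k| := by
            gcongr
            exact norm_add_mul_sqrtD_sq_le α (lam k) hσ
        _ = 2 * α ^ 2 * |α ^ 2 - lam k|⁻¹ + 2 := by field_simp
        _ ≤ _ := by gcongr; exact hB k
    have := mul_le_mul hw (hE t ht σ hσ k) (by positivity) (by positivity)
    linarith
end

section
/- Let 0<ρ<1, T>0, α>0, ε∈(0,1), and let (λ_k) be a nondecreasing sequence of positive reals with λ_k→∞ and λ_k≠α² for all k. Then there exists a constant C>0 such that for every family of continuous functions g_k:[0,T]→ℂ with sup_{0≤t≤T} ∑_k λ_k^{2ε}|g_k(t)|² < ∞, each choice of sign ∓, and every t∈[0,T], one has ∑_k (λ_k²/|α²−λ_k|) |∫₀ᵗ η^{ρ−1} E_{ρ,ρ}(−(α∓√(α²−λ_k)) η^ρ) g_k(t−η) dη|² ≤ C · max_{0≤s≤T} ∑_k λ_k^{2ε}|g_k(s)|². -/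
open MeasureTheory Set Filter

open Complex in
/-- The integral of `f` along the exponential preimage of a Hankel contour: the two half-lines
`x ± φ i`, `x > a`, joined by the vertical segment over `a`. -/
noncomputable def hankelIntegral (φ a : ℝ) (f : ℂ → ℂ) : ℂ :=
  (∫ x in Ioi a, f (x + φ * I)) - (∫ x in Ioi a, f (x + (-φ : ℝ) * I)) +
    I * ∫ y in (-φ)..φ, f (a + y * I)

open Complex in
theorem hankelIntegral_shift {φ a b : ℝ} (hφ : 0 ≤ φ) (hab : a ≤ b) {f : ℂ → ℂ}
    (hf : DifferentiableOn ℂ f {z | |z.im| ≤ φ})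
    (h₁ : IntegrableOn (fun x : ℝ => f (x + φ * I)) (Ioi a))
    (h₂ : IntegrableOn (fun x : ℝ => f (x + (-φ : ℝ) * I)) (Ioi a)) :
    hankelIntegral φ a f = hankelIntegral φ b f := by
  have key := Complex.integral_boundary_rect_eq_zero_of_differentiableOn f
    (a + (-φ : ℝ) * I) (b + φ * I) (hf.mono fun z hz => by
      have h := hz.2
      simp only [mem_preimage, add_im, ofReal_im, mul_im, ofReal_re, I_im, I_re, mul_one, mul_zero,
        add_zero, zero_add, uIcc_of_le (neg_le_self hφ)] at h
      exact abs_le.2 h)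
  have e₁ := intervalIntegral.integral_Ioi_sub_Ioi h₁ hab
  have e₂ := intervalIntegral.integral_Ioi_sub_Ioi h₂ hab
  simp only [add_im, ofReal_im, mul_im, ofReal_re, I_im, I_re, mul_one, mul_zero, mul_re,
    add_zero, zero_add, add_re, sub_zero, smul_eq_mul] at key
  rw [← e₁, ← e₂] at key
  unfold hankelIntegral
  linear_combination -key

open Complex in
theorem integral_ray_sub_ray {φ₁ φ₂ a : ℝ} {f : ℂ → ℂ} {u : ℝ → ℝ} (hφ : φ₁ ≤ φ₂)
    (hf : Differentiable ℂ f)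
    (h₁ : IntegrableOn (fun x : ℝ => f (x + φ₁ * I)) (Ioi a))
    (h₂ : IntegrableOn (fun x : ℝ => f (x + φ₂ * I)) (Ioi a))
    (hu : Tendsto u atTop (nhds 0))
    (hfu : ∀ b : ℝ, ∀ y ∈ Icc φ₁ φ₂, ‖f (b + y * I)‖ ≤ u b) :
    (∫ x in Ioi a, f (x + φ₁ * I)) - (∫ x in Ioi a, f (x + φ₂ * I)) =
      I * ∫ y in φ₁..φ₂, f (a + y * I) := by
  have t₁ := intervalIntegral_tendsto_integral_Ioi a h₁ tendsto_id
  have t₂ := intervalIntegral_tendsto_integral_Ioi a h₂ tendsto_id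
  have t₃ : Tendsto (fun b : ℝ => I * ∫ y in φ₁..φ₂, f (b + y * I)) atTop (nhds 0) := by
    refine squeeze_zero_norm (a := fun b => u b * |φ₂ - φ₁|) (fun b => ?_)
      (by simpa using hu.mul_const |φ₂ - φ₁|)
    rw [norm_mul, norm_I, one_mul]
    refine intervalIntegral.norm_integral_le_of_norm_le_const fun y hy => hfu b y ?_
    rw [uIoc_of_le hφ] at hy
    exact Ioc_subset_Icc_self hy
  have t := (t₁.sub t₂).add t₃
  rw [add_zero] at t
  refine tendsto_nhds_unique t (tendsto_const_nhds.congr fun b => ?_)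
  have key := Complex.integral_boundary_rect_eq_zero_of_differentiableOn f
    (a + φ₁ * I) (b + φ₂ * I) hf.differentiableOn
  simp only [add_im, ofReal_im, mul_im, ofReal_re, I_im, I_re, mul_one, mul_zero, mul_re,
    add_zero, zero_add, add_re, sub_zero, smul_eq_mul] at key
  simp only [id]
  linear_combination -key

theorem eventually_mul_le_mul_exp {c : ℝ} (hc : 0 < c) (m : ℝ) :
    ∀ᶠ x : ℝ in atTop, m * x ≤ c * Real.exp x := by
  have h := (Real.tendsto_mul_exp_add_div_pow_atTop c 0 1 hc).eventually_ge_atTop m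
  filter_upwards [h, eventually_gt_atTop 0] with x hx hx0
  rw [add_zero, pow_one, le_div_iff₀ hx0] at hx
  exact hx

theorem integrableOn_exp_neg_mul_exp_add {c : ℝ} (hc : 0 < c) (m a : ℝ) :
    IntegrableOn (fun x : ℝ => Real.exp (-c * Real.exp x + m * x)) (Ioi a) := by
  refine integrable_of_isBigO_exp_neg one_pos (by fun_prop) ?_
  refine Asymptotics.IsBigO.of_bound 1 ?_
  filter_upwards [eventually_mul_le_mul_exp hc (m + 1)] with x hx
  rw [Real.norm_eq_abs, Real.norm_eq_abs, Real.abs_exp, Real.abs_exp, one_mul, Real.exp_le_exp]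
  linarith

theorem tendsto_exp_neg_mul_exp_add {c : ℝ} (hc : 0 < c) (m : ℝ) :
    Tendsto (fun x : ℝ => Real.exp (-c * Real.exp x + m * x)) atTop (nhds 0) := by
  refine squeeze_zero' (Eventually.of_forall fun x => (Real.exp_pos _).le) ?_
    Real.tendsto_exp_neg_atTop_nhds_zero
  filter_upwards [eventually_mul_le_mul_exp hc (m + 1)] with x hx
  rw [Real.exp_le_exp]
  linarith

/-- The integrand of Hankel's formula for `1 / Γ (μ + 1)` in the logarithmic variable. -/
noncomputable def hankelKernel (μ : ℝ) (ζ : ℂ) : ℂ := Complex.exp (Complex.exp ζ - μ * ζ)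

theorem differentiable_hankelKernel (μ : ℝ) : Differentiable ℂ (hankelKernel μ) := by
  unfold hankelKernel; fun_prop

theorem continuous_hankelKernel (μ : ℝ) : Continuous (hankelKernel μ) :=
  (differentiable_hankelKernel μ).continuous

open Complex in
theorem norm_hankelKernel (μ x y : ℝ) :
    ‖hankelKernel μ (x + y * I)‖ = Real.exp (Real.cos y * Real.exp x + -μ * x) := by
  rw [hankelKernel, norm_exp]
  congr 1
  simp [exp_re]
  ring

open Complex in
theorem integrableOn_hankelKernel {y : ℝ} (hy : Real.cos y < 0) (μ a : ℝ) :
    IntegrableOn (fun x : ℝ => hankelKernel μ (x + y * I)) (Ioi a) := by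
  refine (integrableOn_exp_neg_mul_exp_add (neg_pos.2 hy) (-μ) a).mono'
    ((continuous_hankelKernel μ).comp (by fun_prop)).aestronglyMeasurable
    (Eventually.of_forall fun x => ?_)
  rw [norm_hankelKernel, neg_neg]

theorem cos_neg_of_mem {y : ℝ} (h₁ : Real.pi / 2 < y) (h₂ : y ≤ Real.pi) : Real.cos y < 0 :=
  Real.cos_neg_of_pi_div_two_lt_of_lt h₁ (by linarith [Real.pi_pos])

open Complex in
theorem hankelIntegral_hankelKernel_eq_pi {φ : ℝ} (h₁ : Real.pi / 2 < φ) (h₂ : φ ≤ Real.pi)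
    (μ a : ℝ) :
    hankelIntegral φ a (hankelKernel μ) = hankelIntegral Real.pi a (hankelKernel μ) := by
  have hπ := Real.pi_pos
  have hc : Real.cos φ < 0 := cos_neg_of_mem h₁ h₂
  have hcπ : Real.cos Real.pi < 0 := by simp
  have hu := tendsto_exp_neg_mul_exp_add (neg_pos.2 hc) (-μ)
  have hle : ∀ y ∈ Icc φ Real.pi, Real.cos y ≤ Real.cos φ := fun y hy =>
    Real.cos_le_cos_of_nonneg_of_le_pi (by linarith) hy.2 hy.1
  have hb : ∀ b y : ℝ, Real.cos y ≤ Real.cos φ → ‖hankelKernel μ (b + y * I)‖ ≤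
      Real.exp (-(-Real.cos φ) * Real.exp b + -μ * b) := fun b y hy => by
    rw [norm_hankelKernel, neg_neg]; gcongr
  have up := integral_ray_sub_ray h₂ (differentiable_hankelKernel μ)
    (integrableOn_hankelKernel hc μ a) (integrableOn_hankelKernel hcπ μ a) hu
    fun b y hy => hb b y (hle y hy)
  have down := integral_ray_sub_ray (neg_le_neg h₂) (differentiable_hankelKernel μ)
    (integrableOn_hankelKernel (by rwa [Real.cos_neg]) μ a)
    (integrableOn_hankelKernel (by rwa [Real.cos_neg]) μ a) hu
    fun b y hy => hb b y (by
      rw [← Real.cos_neg]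
      exact hle _ ⟨by linarith [hy.2], by linarith [hy.1]⟩)
  have hi : ∀ c d : ℝ, IntervalIntegrable (fun y : ℝ => hankelKernel μ (a + y * I)) volume c d :=
    fun c d => ((continuous_hankelKernel μ).comp (by fun_prop)).intervalIntegrable c d
  have s₁ := intervalIntegral.integral_add_adjacent_intervals (hi (-Real.pi) (-φ)) (hi (-φ) φ)
  have s₂ := intervalIntegral.integral_add_adjacent_intervals (hi (-Real.pi) φ) (hi φ Real.pi)
  unfold hankelIntegral
  rw [← s₂, ← s₁]
  linear_combination up + down

theorem integrable_and_integral_exp_neg_exp {μ : ℝ} (hμ : μ < 0) :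
    Integrable (fun x : ℝ => Real.exp (-Real.exp x - μ * x)) ∧
      ∫ x : ℝ, Real.exp (-Real.exp x - μ * x) = Real.Gamma (-μ) := by
  have hs : 0 < -μ := neg_pos.2 hμ
  have hd : ∀ x ∈ (univ : Set ℝ), HasDerivWithinAt Real.exp (Real.exp x) univ x :=
    fun x _ => (Real.hasDerivAt_exp x).hasDerivWithinAt
  have hinj : InjOn Real.exp univ := Real.exp_injective.injOn
  have himg : Real.exp '' univ = Ioi 0 := by rw [image_univ, Real.range_exp]
  have he : ∀ x : ℝ, |Real.exp x| • (Real.exp (-Real.exp x) * Real.exp x ^ (-μ - 1)) =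
      Real.exp (-Real.exp x - μ * x) := fun x => by
    rw [Real.abs_exp, smul_eq_mul, ← Real.exp_mul, ← Real.exp_add, ← Real.exp_add]
    congr 1; ring
  constructor
  · have h := (integrableOn_image_iff_integrableOn_abs_deriv_smul MeasurableSet.univ hd hinj
      (fun x => Real.exp (-x) * x ^ (-μ - 1))).1
      (by rw [himg]; exact Real.GammaIntegral_convergent hs)
    simpa only [he, integrableOn_univ] using h
  · have h := integral_image_eq_integral_abs_deriv_smul MeasurableSet.univ hd hinj
      (fun x => Real.exp (-x) * x ^ (-μ - 1))
    rw [himg, ← Real.Gamma_eq_integral hs] at h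
    simpa only [he, setIntegral_univ] using h.symm

open Complex in
theorem hankelKernel_pi (μ x : ℝ) : hankelKernel μ (x + Real.pi * I) =
    (Real.exp (-Real.exp x - μ * x) : ℝ) * exp (-(Real.pi * μ * I)) := by
  rw [hankelKernel, exp_add, exp_pi_mul_I, ofReal_exp, ← exp_add]
  congr 1; push_cast; ring

open Complex in
theorem hankelKernel_neg_pi (μ x : ℝ) : hankelKernel μ (x + (-Real.pi : ℝ) * I) =
    (Real.exp (-Real.exp x - μ * x) : ℝ) * exp (Real.pi * μ * I) := by
  have h : exp ((-Real.pi : ℝ) * I) = -1 := by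
    rw [ofReal_neg, neg_mul, exp_neg, exp_pi_mul_I]; norm_num
  rw [hankelKernel, exp_add, h, ofReal_exp, ← exp_add]
  congr 1; push_cast; ring

open Complex in
theorem hankelIntegral_pi_shift (μ : ℝ) {a b : ℝ} (hab : a ≤ b) :
    hankelIntegral Real.pi a (hankelKernel μ) = hankelIntegral Real.pi b (hankelKernel μ) :=
  hankelIntegral_shift Real.pi_pos.le hab (differentiable_hankelKernel μ).differentiableOn
    (integrableOn_hankelKernel (by simp) μ a) (integrableOn_hankelKernel (by simp) μ a)

open Complex in
theorem hankelIntegral_pi_of_neg {μ : ℝ} (h₁ : -1 < μ) (h₀ : μ < 0) (a : ℝ) :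
    hankelIntegral Real.pi a (hankelKernel μ) = 2 * Real.pi * I / Gamma (μ + 1) := by
  obtain ⟨hint, hval⟩ := integrable_and_integral_exp_neg_exp h₀
  have tray : Tendsto (fun b : ℝ => ∫ x in Ioi b, Real.exp (-Real.exp x - μ * x)) atBot
      (nhds (Real.Gamma (-μ))) := by
    rw [← hval]
    exact (aecover_Ioi tendsto_id).integral_tendsto_of_countably_generated hint
  have tray' := (continuous_ofReal.tendsto _).comp tray
  have tarc : Tendsto (fun b : ℝ => I * ∫ y in (-Real.pi)..Real.pi, hankelKernel μ (b + y * I))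
      atBot (nhds 0) := by
    have hlim : Tendsto (fun b : ℝ => Real.exp (Real.exp b + -μ * b)) atBot (nhds 0) := by
      refine Real.tendsto_exp_atBot.comp ?_
      exact Real.tendsto_exp_atBot.add_atBot (tendsto_id.const_mul_atBot (neg_pos.2 h₀))
    refine squeeze_zero_norm
      (a := fun b : ℝ => Real.exp (Real.exp b + -μ * b) * |Real.pi - -Real.pi|)
      (fun b => ?_) (by simpa only [zero_mul] using hlim.mul_const |Real.pi - -Real.pi|)
    rw [norm_mul, norm_I, one_mul]
    refine intervalIntegral.norm_integral_le_of_norm_le_const fun y hy => ?_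
    rw [norm_hankelKernel]
    gcongr
    exact mul_le_of_le_one_left (Real.exp_pos b).le (Real.cos_le_one y)
  have hlim := ((tray'.mul_const (exp (-(Real.pi * μ * I)))).sub
    (tray'.mul_const (exp (Real.pi * μ * I)))).add tarc
  have heq : ∀ᶠ b : ℝ in atBot, hankelIntegral Real.pi a (hankelKernel μ) =
      ((Complex.ofReal ∘ fun b : ℝ => ∫ x in Ioi b, Real.exp (-Real.exp x - μ * x)) b *
        exp (-(Real.pi * μ * I)) -
      (Complex.ofReal ∘ fun b : ℝ => ∫ x in Ioi b, Real.exp (-Real.exp x - μ * x)) b *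
        exp (Real.pi * μ * I)) +
      I * ∫ y in (-Real.pi)..Real.pi, hankelKernel μ (b + y * I) := by
    filter_upwards [eventually_le_atBot a] with b hb
    rw [← hankelIntegral_pi_shift μ hb, hankelIntegral]
    simp only [hankelKernel_pi, hankelKernel_neg_pi, integral_mul_const, integral_complex_ofReal,
      Function.comp]
  rw [tendsto_nhds_unique (tendsto_const_nhds.congr' heq) hlim]
  have hsin : Real.sin (Real.pi * μ) ≠ 0 := by
    have := Real.sin_pos_of_pos_of_lt_pi (x := -(Real.pi * μ))
      (by nlinarith [Real.pi_pos]) (by nlinarith [Real.pi_pos])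
    rw [Real.sin_neg] at this
    linarith
  have hsin' : sin (Real.pi * μ) ≠ 0 := by exact_mod_cast hsin
  have hG : Gamma (μ + 1) ≠ 0 := by
    refine Gamma_ne_zero_of_re_pos ?_
    simp; linarith
  have hrefl := Gamma_mul_Gamma_one_sub (-(μ : ℂ))
  rw [mul_neg, sin_neg, sub_neg_eq_add, add_comm (1 : ℂ), eq_div_iff (neg_ne_zero.2 hsin')] at hrefl
  have hsd : sin (Real.pi * μ) = (exp (-(Real.pi * μ * I)) - exp (Real.pi * μ * I)) * I / 2 := by
    rw [sin, neg_mul]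
  rw [hsd] at hrefl
  rw [eq_div_iff hG, ← Complex.Gamma_ofReal]
  push_cast
  linear_combination (2 * I) * hrefl + (Gamma (-μ) * Gamma (μ + 1) *
    (exp (-(Real.pi * μ * I)) - exp (Real.pi * μ * I))) * I_sq

open Complex in
theorem hankelIntegral_pi_zero (a : ℝ) :
    hankelIntegral Real.pi a (hankelKernel 0) = 2 * Real.pi * I := by
  have hper : Function.Periodic (fun y : ℝ => hankelKernel 0 (a + y * I)) (2 * Real.pi) := by
    intro y
    have : (a : ℂ) + (y + 2 * Real.pi : ℝ) * I = a + y * I + 2 * Real.pi * I := by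
      push_cast; ring
    simp only [hankelKernel, this, exp_periodic (a + y * I), ofReal_zero, zero_mul]
  have hcirc : (∮ z in C(0, Real.exp a), (z - 0)⁻¹ • exp z) = (2 * Real.pi * I : ℂ) • exp 0 :=
    differentiable_exp.diffContOnCl.circleIntegral_sub_inv_smul (by simp [Real.exp_pos])
  rw [exp_zero, smul_eq_mul, mul_one] at hcirc
  have harc := hper.intervalIntegral_add_eq (-Real.pi) 0
  rw [show -Real.pi + 2 * Real.pi = Real.pi by ring, zero_add] at harc
  have hval : I * ∫ y in (0 : ℝ)..2 * Real.pi, hankelKernel 0 (a + y * I) = 2 * Real.pi * I := by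
    rw [← hcirc, circleIntegral, ← intervalIntegral.integral_const_mul]
    refine intervalIntegral.integral_congr fun y _ => ?_
    have hz : circleMap 0 (Real.exp a) y = exp (a + y * I) := by
      rw [circleMap_zero, ofReal_exp, exp_add]
    simp only [deriv_circleMap, hz, sub_zero, smul_eq_mul, hankelKernel, ofReal_zero, zero_mul]
    field_simp [exp_ne_zero]
  rw [hankelIntegral, harc, hval]
  simp only [hankelKernel_pi, hankelKernel_neg_pi]
  simp

open Complex in
theorem hasDerivAt_hankelKernel (μ : ℝ) (ζ : ℂ) :
    HasDerivAt (hankelKernel μ) (hankelKernel (μ - 1) ζ - μ * hankelKernel μ ζ) ζ := by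
  have h := ((hasDerivAt_exp ζ).sub ((hasDerivAt_id ζ).const_mul (μ : ℂ))).cexp
  refine h.congr_deriv ?_
  have e : hankelKernel (μ - 1) ζ = exp (exp ζ - μ * ζ) * exp ζ := by
    rw [hankelKernel, ← exp_add]; congr 1; push_cast; ring
  rw [e, hankelKernel]
  simp only [id, Pi.sub_apply]
  ring

open Complex in
theorem integral_ray_hankelKernel_sub_one {y : ℝ} (hy : Real.cos y < 0) (μ a : ℝ) :
    (∫ x in Ioi a, hankelKernel (μ - 1) (x + y * I)) -
      μ * ∫ x in Ioi a, hankelKernel μ (x + y * I) = -hankelKernel μ (a + y * I) := by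
  have i₁ := integrableOn_hankelKernel hy (μ - 1) a
  have i₂ := (integrableOn_hankelKernel hy μ a).const_mul (μ : ℂ)
  rw [← integral_const_mul, ← integral_sub i₁ i₂, ← zero_sub (hankelKernel μ _)]
  refine integral_Ioi_of_hasDerivAt_of_tendsto (f := fun x : ℝ => hankelKernel μ (x + y * I))
    ((continuous_hankelKernel μ).comp (by fun_prop)).continuousWithinAt (fun x _ => ?_)
    (i₁.sub i₂) ?_
  · exact ((hasDerivAt_hankelKernel μ (x + y * I)).comp_add_const (x : ℂ) (y * I)).comp_ofReal
  · rw [tendsto_zero_iff_norm_tendsto_zero]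
    simp only [norm_hankelKernel]
    simpa only [neg_neg] using tendsto_exp_neg_mul_exp_add (neg_pos.2 hy) (-μ)

open Complex in
theorem hankelIntegral_pi_sub_one (μ a : ℝ) :
    hankelIntegral Real.pi a (hankelKernel (μ - 1)) =
      μ * hankelIntegral Real.pi a (hankelKernel μ) := by
  have r₁ := integral_ray_hankelKernel_sub_one (y := Real.pi) (by simp) μ a
  have r₂ := integral_ray_hankelKernel_sub_one (y := -Real.pi) (by simp) μ a
  have hc : ∀ ν : ℝ, Continuous fun y : ℝ => hankelKernel ν (a + y * I) := fun ν =>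
    (continuous_hankelKernel ν).comp (by fun_prop)
  have arc : I * ((∫ y in (-Real.pi)..Real.pi, hankelKernel (μ - 1) (a + y * I)) -
      μ * ∫ y in (-Real.pi)..Real.pi, hankelKernel μ (a + y * I)) =
      hankelKernel μ (a + Real.pi * I) - hankelKernel μ (a + (-Real.pi : ℝ) * I) := by
    rw [← intervalIntegral.integral_const_mul, ← intervalIntegral.integral_sub
      ((hc _).intervalIntegrable _ _) (((hc _).const_mul _).intervalIntegrable _ _),
      ← intervalIntegral.integral_const_mul]
    refine intervalIntegral.integral_eq_sub_of_hasDerivAt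
      (f := fun y : ℝ => hankelKernel μ (a + y * I)) (fun y _ => ?_)
      (((hc _).sub ((hc _).const_mul _)).const_mul _ |>.intervalIntegrable _ _)
    have hin : HasDerivAt (fun y : ℝ => (a : ℂ) + y * I) I y := by
      simpa using ((hasDerivAt_id y).ofReal_comp.mul_const I).const_add (a : ℂ)
    exact ((hasDerivAt_hankelKernel μ (a + y * I)).comp y hin).congr_deriv (mul_comm _ _)
  unfold hankelIntegral
  linear_combination r₁ - r₂ + arc

open Complex in
/-- Hankel's formula for the reciprocal Gamma function. -/
theorem hankelIntegral_hankelKernel {φ : ℝ} (hφ₁ : Real.pi / 2 < φ) (hφ₂ : φ ≤ Real.pi) {μ : ℝ}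
    (hμ : -1 < μ) (a : ℝ) :
    hankelIntegral φ a (hankelKernel μ) = 2 * Real.pi * I / Gamma (μ + 1) := by
  rw [hankelIntegral_hankelKernel_eq_pi hφ₁ hφ₂]
  obtain ⟨n, hn⟩ := exists_nat_ge μ
  induction n generalizing μ with
  | zero =>
    rcases (show μ ≤ 0 by simpa using hn).lt_or_eq with h | rfl
    · exact hankelIntegral_pi_of_neg hμ h a
    · simp [hankelIntegral_pi_zero]
  | succ n ih =>
    rcases lt_trichotomy μ 0 with h | rfl | h
    · exact hankelIntegral_pi_of_neg hμ h a
    · simp [hankelIntegral_pi_zero]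
    · have h' := hankelIntegral_pi_sub_one μ a
      have hμ0 : (μ : ℂ) ≠ 0 := by exact_mod_cast h.ne'
      rw [ih (by linarith) (by push_cast at hn; linarith)] at h'
      rw [Gamma_add_one _ hμ0, eq_div_iff (mul_ne_zero hμ0
        (Gamma_ne_zero_of_re_pos (by simpa using h)))]
      have hG : Gamma (μ : ℂ) ≠ 0 := Gamma_ne_zero_of_re_pos (by simpa using h)
      rw [ofReal_sub, ofReal_one, sub_add_cancel, div_eq_iff hG] at h'
      linear_combination -h'

/-- The resolvent-type integrand representing `mlE ρ ρ (-w)`, in the logarithmic variable. -/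
noncomputable def mlKernel (ρ : ℝ) (w ζ : ℂ) : ℂ :=
  hankelKernel (-1) ζ / (Complex.exp (ρ * ζ) + w)

open Complex in
theorem hankelKernel_succ (ρ : ℝ) (n : ℕ) (ζ : ℂ) :
    hankelKernel (ρ * (n + 1) - 1) ζ = hankelKernel (ρ - 1) ζ * exp (-(ρ * ζ)) ^ n := by
  rw [hankelKernel, hankelKernel, ← exp_nat_mul, ← exp_add]
  congr 1; push_cast; ring

open Complex in
theorem hasSum_mlKernel {ρ : ℝ} {w ζ : ℂ} (h : ‖w‖ < ‖exp (ρ * ζ)‖) :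
    HasSum (fun n : ℕ => (-w) ^ n * hankelKernel (ρ * (n + 1) - 1) ζ) (mlKernel ρ w ζ) := by
  have hlt : ‖-w * exp (-(ρ * ζ))‖ < 1 := by
    rw [norm_mul, norm_neg, exp_neg, norm_inv, ← div_eq_mul_inv]
    exact (div_lt_one (norm_pos_iff.2 (exp_ne_zero _))).2 h
  have hs := (hasSum_geometric_of_norm_lt_one hlt).mul_left (hankelKernel (ρ - 1) ζ)
  have hne : exp (ρ * ζ) + w ≠ 0 := fun h0 => by
    rw [eq_neg_of_add_eq_zero_left h0, norm_neg] at h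
    exact lt_irrefl _ h
  have hterm : ∀ n : ℕ, (-w) ^ n * hankelKernel (ρ * (n + 1) - 1) ζ =
      hankelKernel (ρ - 1) ζ * (-w * exp (-(ρ * ζ))) ^ n := fun n => by
    rw [hankelKernel_succ, mul_pow]; ring
  have e : hankelKernel (ρ - 1) ζ = hankelKernel (-1) ζ * (exp (ρ * ζ))⁻¹ := by
    rw [hankelKernel, hankelKernel, ← exp_neg, ← exp_add]
    congr 1; push_cast; ring
  have e' : 1 - -w * exp (-(ρ * ζ)) = (exp (ρ * ζ) + w) * (exp (ρ * ζ))⁻¹ := by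
    rw [exp_neg, add_mul, mul_inv_cancel₀ (exp_ne_zero _)]; ring
  have hval : mlKernel ρ w ζ = hankelKernel (ρ - 1) ζ * (1 - -w * exp (-(ρ * ζ)))⁻¹ := by
    rw [e, e', mlKernel]
    field_simp [exp_ne_zero]
  simp only [hterm, hval]
  exact hs

open Complex in
theorem hasSum_setIntegral_mlKernel {ρ : ℝ} {w : ℂ} {S : Set ℝ} (hS : MeasurableSet S)
    {γ : ℝ → ℂ} (hγ : Continuous γ) (hw : w ≠ 0)
    (hle : ∀ x ∈ S, 2 * ‖w‖ ≤ ‖exp (ρ * γ x)‖)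
    (hint : IntegrableOn (fun x => hankelKernel (ρ - 1) (γ x)) S) :
    HasSum (fun n : ℕ => (-w) ^ n * ∫ x in S, hankelKernel (ρ * (n + 1) - 1) (γ x))
      (∫ x in S, mlKernel ρ w (γ x)) := by
  have hw' := norm_pos_iff.2 hw
  have hbound : ∀ n : ℕ, ∀ x ∈ S, ‖(-w) ^ n * hankelKernel (ρ * (n + 1) - 1) (γ x)‖ ≤
      (1 / 2) ^ n * ‖hankelKernel (ρ - 1) (γ x)‖ := fun n x hx => by
    have h1 : ‖-w * exp (-(ρ * γ x))‖ ≤ 1 / 2 := by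
      rw [norm_mul, norm_neg, exp_neg, norm_inv, ← div_eq_mul_inv,
        div_le_iff₀ (norm_pos_iff.2 (exp_ne_zero _))]
      linarith [hle x hx]
    rw [hankelKernel_succ, mul_left_comm, ← mul_pow, norm_mul, norm_pow, mul_comm]
    gcongr
  have hI : ∀ n : ℕ, IntegrableOn
      (fun x => (-w) ^ n * hankelKernel (ρ * (n + 1) - 1) (γ x)) S := fun n =>
    (hint.norm.const_mul ((1 / 2) ^ n)).mono'
      (((continuous_hankelKernel _).comp hγ).const_mul _).aestronglyMeasurable
      (ae_restrict_of_forall_mem hS (hbound n))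
  have hsum := hasSum_integral_of_summable_integral_norm hI (by
    refine Summable.of_nonneg_of_le (fun n => integral_nonneg fun x => norm_nonneg _) (fun n => ?_)
      (summable_geometric_two.mul_right (∫ x in S, ‖hankelKernel (ρ - 1) (γ x)‖))
    rw [← integral_const_mul]
    exact setIntegral_mono_on (hI n).norm (hint.norm.const_mul _) hS (hbound n))
  simp only [integral_const_mul] at hsum
  have hval : ∫ x in S, mlKernel ρ w (γ x) =
      ∫ x in S, ∑' n : ℕ, (-w) ^ n * hankelKernel (ρ * (n + 1) - 1) (γ x) :=
    setIntegral_congr_fun hS fun x hx =>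
      (hasSum_mlKernel (by linarith [hle x hx])).tsum_eq.symm
  rw [hval]
  exact hsum

open Complex in
theorem cos_mul_norm_exp_le {ρ φ : ℝ} (hρ : 0 < ρ) (hφ : ρ * φ < Real.pi / 2) {w ζ : ℂ}
    (hw : 0 ≤ w.re) (hζ : |ζ.im| ≤ φ) :
    Real.cos (ρ * φ) * ‖exp (ρ * ζ)‖ ≤ ‖exp (ρ * ζ) + w‖ := by
  have h1 : Real.cos (ρ * φ) ≤ Real.cos (ρ * ζ.im) := by
    rw [← Real.cos_abs (ρ * ζ.im), abs_mul, abs_of_pos hρ]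
    exact Real.cos_le_cos_of_nonneg_of_le_pi (by positivity) (by linarith [Real.pi_pos])
      (by gcongr)
  have h2 : (exp (ρ * ζ)).re = ‖exp (ρ * ζ)‖ * Real.cos (ρ * ζ.im) := by
    rw [exp_re, norm_exp]; simp
  calc _ ≤ ‖exp (ρ * ζ)‖ * Real.cos (ρ * ζ.im) := by
          rw [mul_comm]; gcongr
    _ ≤ (exp (ρ * ζ) + w).re := by rw [add_re, h2]; linarith
    _ ≤ _ := re_le_norm _

theorem norm_exp_ofReal_mul_add (ρ x y : ℝ) :
    ‖Complex.exp (ρ * (x + y * Complex.I))‖ = Real.exp (ρ * x) := by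
  rw [Complex.norm_exp]; simp

open Complex in
theorem norm_mlKernel_le {ρ φ δ : ℝ} (hρ : 0 < ρ) (hφ0 : 0 ≤ φ) (hφ : ρ * φ < Real.pi / 2)
    (hδ0 : 0 ≤ δ) (hδ1 : δ ≤ 1) {w : ℂ} (hw : 0 ≤ w.re) (hw0 : w ≠ 0) {x y : ℝ} (hx : 0 ≤ x)
    (hy : |y| ≤ φ) :
    ‖mlKernel ρ w (x + y * I)‖ ≤ (1 + Real.cos (ρ * φ)) / Real.cos (ρ * φ) * ‖w‖ ^ (-δ) *
      ‖hankelKernel (-1) (x + y * I)‖ := by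
  have hc : 0 < Real.cos (ρ * φ) :=
    Real.cos_pos_of_mem_Ioo ⟨by linarith [Real.pi_pos, mul_nonneg hρ.le hφ0], hφ⟩
  set c := Real.cos (ρ * φ)
  have hwp := norm_pos_iff.2 hw0
  have hmain := cos_mul_norm_exp_le (ζ := x + y * I) hρ hφ hw (by simpa using hy)
  have hv : 1 ≤ ‖exp (ρ * (x + y * I))‖ := by
    rw [norm_exp_ofReal_mul_add]; exact Real.one_le_exp (by positivity)
  set v := exp (ρ * (x + y * I))
  have htri : ‖w‖ ≤ ‖v + w‖ + ‖v‖ := by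
    simpa using norm_sub_le (v + w) v
  have hcv : c ≤ ‖v + w‖ := by nlinarith
  have hcw : c * ‖w‖ ≤ (1 + c) * ‖v + w‖ := by nlinarith
  have hpow : c * ‖w‖ ^ δ ≤ (1 + c) * ‖v + w‖ := by
    rcases le_total ‖w‖ 1 with h | h
    · have := Real.rpow_le_one hwp.le h hδ0
      nlinarith
    · have := Real.rpow_le_rpow_of_exponent_le h hδ1
      rw [Real.rpow_one] at this
      nlinarith
  have hpos : 0 < ‖v + w‖ := hc.trans_le hcv
  have hinv : 1 / ‖v + w‖ ≤ (1 + c) / c * ‖w‖ ^ (-δ) := by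
    rw [Real.rpow_neg hwp.le, ← div_eq_mul_inv, div_div, div_le_div_iff₀ hpos (by positivity)]
    linarith
  rw [mlKernel, norm_div, div_eq_mul_one_div, mul_comm]
  gcongr

open Complex in
theorem norm_hankelIntegral_le {φ a : ℝ} (hφ : 0 ≤ φ) {f g : ℂ → ℂ} {M : ℝ}
    (hg₁ : IntegrableOn (fun x : ℝ => g (x + φ * I)) (Ioi a))
    (hg₂ : IntegrableOn (fun x : ℝ => g (x + (-φ : ℝ) * I)) (Ioi a))
    (hg₃ : IntervalIntegrable (fun y : ℝ => g (a + y * I)) volume (-φ) φ)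
    (hfg : ∀ x y : ℝ, a ≤ x → |y| ≤ φ → ‖f (x + y * I)‖ ≤ M * ‖g (x + y * I)‖) :
    ‖hankelIntegral φ a f‖ ≤ M * ((∫ x in Ioi a, ‖g (x + φ * I)‖) +
      (∫ x in Ioi a, ‖g (x + (-φ : ℝ) * I)‖) + ∫ y in (-φ)..φ, ‖g (a + y * I)‖) := by
  have b₁ : ‖∫ x in Ioi a, f (x + φ * I)‖ ≤ M * ∫ x in Ioi a, ‖g (x + φ * I)‖ := by
    rw [← integral_const_mul]
    refine norm_integral_le_of_norm_le (hg₁.norm.const_mul M)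
      (ae_restrict_of_forall_mem measurableSet_Ioi fun x hx => hfg x φ (le_of_lt hx) ?_)
    rw [abs_of_nonneg hφ]
  have b₂ : ‖∫ x in Ioi a, f (x + (-φ : ℝ) * I)‖ ≤
      M * ∫ x in Ioi a, ‖g (x + (-φ : ℝ) * I)‖ := by
    rw [← integral_const_mul]
    refine norm_integral_le_of_norm_le (hg₂.norm.const_mul M)
      (ae_restrict_of_forall_mem measurableSet_Ioi fun x hx => hfg x (-φ) (le_of_lt hx) ?_)
    rw [abs_neg, abs_of_nonneg hφ]
  have b₃ : ‖I * ∫ y in (-φ)..φ, f (a + y * I)‖ ≤ M * ∫ y in (-φ)..φ, ‖g (a + y * I)‖ := by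
    rw [norm_mul, norm_I, one_mul, ← intervalIntegral.integral_const_mul]
    refine intervalIntegral.norm_integral_le_of_norm_le (neg_le_self hφ)
      (Eventually.of_forall fun y hy => hfg a y le_rfl (abs_le.2 ⟨hy.1.le, hy.2⟩))
      (hg₃.norm.const_mul M)
  calc _ ≤ _ := (norm_add_le _ _).trans (add_le_add_left (norm_sub_le _ _) _)
    _ ≤ _ := by linarith

open Complex in
theorem hankelIntegral_mlKernel {ρ φ : ℝ} (hρ0 : 0 < ρ) (hφ₁ : Real.pi / 2 < φ)
    (hφ₂ : φ ≤ Real.pi) (hφ : ρ * φ < Real.pi / 2) {w : ℂ} (hw : 0 ≤ w.re) (hw0 : w ≠ 0) :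
    hankelIntegral φ 0 (mlKernel ρ w) = 2 * Real.pi * I * mlE ρ ρ (-w) := by
  have hφ0 : 0 ≤ φ := by linarith [Real.pi_pos]
  have hcφ := cos_neg_of_mem hφ₁ hφ₂
  have hcφ' : Real.cos (-φ) < 0 := by rwa [Real.cos_neg]
  have hc : 0 < Real.cos (ρ * φ) :=
    Real.cos_pos_of_mem_Ioo ⟨by linarith [Real.pi_pos, mul_nonneg hρ0.le hφ0], hφ⟩
  have hne : ∀ ζ : ℂ, |ζ.im| ≤ φ → exp (ρ * ζ) + w ≠ 0 := fun ζ hζ => by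
    rw [← norm_pos_iff]
    exact (mul_pos hc (norm_pos_iff.2 (exp_ne_zero _))).trans_le
      (cos_mul_norm_exp_le hρ0 hφ hw hζ)
  have hint : ∀ y : ℝ, |y| ≤ φ → Real.cos y < 0 →
      IntegrableOn (fun x : ℝ => mlKernel ρ w (x + y * I)) (Ioi 0) := fun y hy hcy => by
    refine ((integrableOn_hankelKernel hcy (-1) 0).norm.const_mul _).mono' ?_
      (ae_restrict_of_forall_mem measurableSet_Ioi fun x hx =>
        norm_mlKernel_le hρ0 hφ0 hφ zero_le_one le_rfl hw hw0 (le_of_lt hx) hy)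
    refine Continuous.aestronglyMeasurable ?_
    unfold mlKernel
    exact ((continuous_hankelKernel _).comp (by fun_prop)).div (by fun_prop)
      fun x => hne _ (by simpa using hy)
  obtain ⟨a, ha⟩ : ∃ a : ℝ, 0 ≤ a ∧ 2 * ‖w‖ ≤ Real.exp (ρ * a) := by
    have ht : Tendsto (fun a : ℝ => Real.exp (ρ * a)) atTop atTop :=
      Real.tendsto_exp_atTop.comp (tendsto_id.const_mul_atTop hρ0)
    exact ((eventually_ge_atTop 0).and (ht.eventually_ge_atTop _)).exists
  have hdiff : DifferentiableOn ℂ (mlKernel ρ w) {z | |z.im| ≤ φ} := fun ζ hζ =>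
    ((differentiable_hankelKernel (-1)).differentiableAt.fun_div
      (d := fun z => exp (ρ * z) + w) (by fun_prop) (hne ζ hζ)).differentiableWithinAt
  rw [hankelIntegral_shift hφ0 ha.1 hdiff
    (hint φ (abs_of_nonneg hφ0).le hcφ)
    (hint (-φ) (by rw [abs_neg, abs_of_nonneg hφ0]) hcφ')]
  have hle : ∀ x y : ℝ, a ≤ x → 2 * ‖w‖ ≤ ‖exp (ρ * (x + y * I))‖ := fun x y hx => by
    rw [norm_exp_ofReal_mul_add]
    exact ha.2.trans (Real.exp_le_exp.2 (by gcongr))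
  have s₁ := hasSum_setIntegral_mlKernel (ρ := ρ) (γ := fun x : ℝ => x + φ * I)
    measurableSet_Ioi (by fun_prop) hw0 (fun x hx => hle x φ (le_of_lt hx))
    (integrableOn_hankelKernel hcφ (ρ - 1) a)
  have s₂ := hasSum_setIntegral_mlKernel (ρ := ρ) (γ := fun x : ℝ => x + (-φ : ℝ) * I)
    measurableSet_Ioi (by fun_prop) hw0 (fun x hx => hle x (-φ) (le_of_lt hx))
    (integrableOn_hankelKernel hcφ' (ρ - 1) a)
  have s₃ := hasSum_setIntegral_mlKernel (ρ := ρ) (γ := fun y : ℝ => a + y * I)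
    (S := Ioc (-φ) φ) measurableSet_Ioc (by fun_prop) hw0 (fun y _ => hle a y le_rfl)
    (((continuous_hankelKernel (ρ - 1)).comp (by fun_prop)).integrableOn_Ioc)
  have s := (s₁.sub s₂).add (s₃.mul_left I)
  simp only [← intervalIntegral.integral_of_le (neg_le_self hφ0)] at s
  have hterm : ∀ n : ℕ, (2 * Real.pi * I) * ((-w) ^ n / Gamma (((ρ * n : ℝ) : ℂ) + ρ)) =
      (-w) ^ n * (∫ x in Ioi a, hankelKernel (ρ * (n + 1) - 1) (x + φ * I)) -
      (-w) ^ n * (∫ x in Ioi a, hankelKernel (ρ * (n + 1) - 1) (x + (-φ : ℝ) * I)) +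
      I * ((-w) ^ n * ∫ y in (-φ)..φ, hankelKernel (ρ * (n + 1) - 1) (a + y * I)) := fun n => by
    have h := hankelIntegral_hankelKernel hφ₁ hφ₂ (μ := ρ * (n + 1) - 1)
      (by have : 0 < ρ * (n + 1) := by positivity
          linarith) a
    have e : (((ρ * (n + 1) - 1 : ℝ) : ℂ) + 1) = ((ρ * n : ℝ) : ℂ) + ρ := by push_cast; ring
    rw [e, hankelIntegral] at h
    linear_combination -((-w) ^ n) * h
  rw [mlE, ← tsum_mul_left, tsum_congr hterm, s.tsum_eq, hankelIntegral]

theorem exists_norm_mlE_le_s18 {ρ δ : ℝ} (hρ0 : 0 < ρ) (hρ1 : ρ < 1) (hδ0 : 0 ≤ δ) (hδ1 : δ ≤ 1) :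
    ∃ C > 0, ∀ w : ℂ, 0 ≤ w.re → w ≠ 0 → ‖mlE ρ ρ (-w)‖ ≤ C * ‖w‖ ^ (-δ) := by
  have hπ := Real.pi_pos
  obtain ⟨φ, hφ⟩ : ∃ φ : ℝ, φ = Real.pi / (1 + ρ) := ⟨_, rfl⟩
  have hφ₁ : Real.pi / 2 < φ := by rw [hφ]; gcongr; linarith
  have hφ₂ : φ ≤ Real.pi := by rw [hφ]; exact div_le_self hπ.le (by linarith)
  have hφ₃ : ρ * φ < Real.pi / 2 := by
    have : φ * (1 + ρ) = Real.pi := by rw [hφ]; field_simp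
    linarith
  have hφ0 : 0 ≤ φ := by linarith
  have hcφ := cos_neg_of_mem hφ₁ hφ₂
  have hc : 0 < Real.cos (ρ * φ) :=
    Real.cos_pos_of_mem_Ioo ⟨by linarith [mul_nonneg hρ0.le hφ0], hφ₃⟩
  obtain ⟨L, hL⟩ : ∃ L : ℝ, L = (∫ x in Ioi (0 : ℝ), ‖hankelKernel (-1) (x + φ * Complex.I)‖) +
      (∫ x in Ioi (0 : ℝ), ‖hankelKernel (-1) (x + (-φ : ℝ) * Complex.I)‖) +
      ∫ y in (-φ)..φ, ‖hankelKernel (-1) ((0 : ℝ) + y * Complex.I)‖ := ⟨_, rfl⟩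
  have hL0 : 0 ≤ L := by
    rw [hL]
    have := intervalIntegral.integral_nonneg (neg_le_self hφ0) (μ := volume)
      (f := fun y : ℝ => ‖hankelKernel (-1) ((0 : ℝ) + y * Complex.I)‖) fun y _ => norm_nonneg _
    positivity
  obtain ⟨A, hA⟩ : ∃ A : ℝ, A = (1 + Real.cos (ρ * φ)) / Real.cos (ρ * φ) := ⟨_, rfl⟩
  have hA0 : 0 < A := by rw [hA]; positivity
  refine ⟨A * L + 1, by positivity, fun w hw hw0 => ?_⟩
  have hb := norm_hankelIntegral_le (a := 0) (f := mlKernel ρ w) (g := hankelKernel (-1)) hφ0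
    (integrableOn_hankelKernel hcφ (-1) 0)
    (integrableOn_hankelKernel (by rwa [Real.cos_neg]) (-1) 0)
    (((continuous_hankelKernel _).comp (by fun_prop)).intervalIntegrable _ _)
    (fun x y hx hy => norm_mlKernel_le hρ0 hφ0 hφ₃ hδ0 hδ1 hw hw0 hx hy)
  rw [hankelIntegral_mlKernel hρ0 hφ₁ hφ₂ hφ₃ hw hw0, ← hL, ← hA, norm_mul] at hb
  have h2π : 1 ≤ ‖(2 * Real.pi * Complex.I : ℂ)‖ := by
    simp [abs_of_pos hπ]; linarith [Real.pi_gt_three]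
  have hw1 : 0 ≤ ‖w‖ ^ (-δ) := by positivity
  calc _ ≤ _ := le_mul_of_one_le_left (norm_nonneg _) h2π
    _ ≤ _ := hb
    _ ≤ _ := by linarith

theorem sqrtD_of_le {α lam : ℝ} (h : lam ≤ α ^ 2) : sqrtD α lam = (√(α ^ 2 - lam) : ℝ) := by
  rw [sqrtD, Real.sqrt_eq_rpow, Complex.ofReal_cpow (sub_nonneg.2 h)]
  norm_num

theorem sqrtD_of_ge {α lam : ℝ} (h : α ^ 2 ≤ lam) :
    sqrtD α lam = (√(lam - α ^ 2) : ℝ) * Complex.I := by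
  rw [sqrtD, Complex.ofReal_cpow_of_nonpos (sub_nonpos.2 h), ← Complex.ofReal_neg, neg_sub,
    Real.sqrt_eq_rpow, Complex.ofReal_cpow (sub_nonneg.2 h),
    show (Real.pi * Complex.I * (1 / 2) : ℂ) = Real.pi / 2 * Complex.I by ring,
    Complex.exp_pi_div_two_mul_I]
  norm_num

theorem re_add_mul_sqrtD_pos {α lam : ℝ} (hα : 0 < α) (hlam : 0 < lam) {σ : ℂ}
    (hσ : σ = 1 ∨ σ = -1) : 0 < ((α : ℂ) + σ * sqrtD α lam).re := by
  rcases le_total lam (α ^ 2) with h | h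
  · have hs : √(α ^ 2 - lam) < α := by
      rw [Real.sqrt_lt' hα]; linarith
    have hs0 := Real.sqrt_nonneg (α ^ 2 - lam)
    rw [sqrtD_of_le h]
    rcases hσ with rfl | rfl <;> simp <;> linarith
  · rw [sqrtD_of_ge h]
    rcases hσ with rfl | rfl <;> simpa using hα

theorem norm_add_mul_sqrtD_sq {α lam : ℝ} (h : α ^ 2 ≤ lam) {σ : ℂ} (hσ : σ = 1 ∨ σ = -1) :
    ‖(α : ℂ) + σ * sqrtD α lam‖ ^ 2 = lam := by
  have hs := Real.sq_sqrt (sub_nonneg.2 h)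
  rw [sqrtD_of_ge h, ← Complex.normSq_eq_norm_sq, Complex.normSq_apply]
  rcases hσ with rfl | rfl <;> simp <;> nlinarith

theorem exists_weight_le {α ε : ℝ} (hε0 : 0 < ε) {lam : ℕ → ℝ}
    (hlam_pos : ∀ k, 0 < lam k) (hlam_tend : Tendsto lam atTop atTop) {σ : ℂ}
    (hσ : σ = 1 ∨ σ = -1) :
    ∃ D > 0, ∀ k, lam k ^ 2 / |α ^ 2 - lam k| *
      (‖(α : ℂ) + σ * sqrtD α (lam k)‖ ^ (-(1 - ε))) ^ 2 ≤ D * lam k ^ (2 * ε) := by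
  obtain ⟨r, hr⟩ : ∃ r : ℕ → ℝ, r = fun k => lam k ^ 2 / |α ^ 2 - lam k| *
      (‖(α : ℂ) + σ * sqrtD α (lam k)‖ ^ (-(1 - ε))) ^ 2 / lam k ^ (2 * ε) := ⟨_, rfl⟩
  have hbdd : BddAbove (range r) := by
    refine Filter.IsBoundedUnder.bddAbove_range ⟨2, ?_⟩
    rw [eventually_map]
    filter_upwards [hlam_tend.eventually_ge_atTop (2 * α ^ 2), hlam_tend.eventually_ge_atTop 1]
      with k h₁ h₂
    have hl := hlam_pos k
    have hnorm := norm_add_mul_sqrtD_sq (α := α) (lam := lam k) (by nlinarith [sq_nonneg α]) hσ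
    have habs : lam k / 2 ≤ |α ^ 2 - lam k| := by
      rw [abs_sub_comm]; exact le_trans (by linarith) (le_abs_self _)
    have hpow : (‖(α : ℂ) + σ * sqrtD α (lam k)‖ ^ (-(1 - ε))) ^ 2 = lam k ^ (ε - 1) := by
      rw [← Real.rpow_mul_natCast (norm_nonneg _), mul_comm (-(1 - ε)), Real.rpow_mul (norm_nonneg _),
        Real.rpow_natCast, hnorm]
      congr 1; ring
    have hw : lam k ^ 2 / |α ^ 2 - lam k| ≤ 2 * lam k := by
      rw [div_le_iff₀ (by linarith)]; nlinarith
    rw [hr]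
    simp only
    rw [hpow, div_le_iff₀ (by positivity)]
    calc _ ≤ 2 * lam k * lam k ^ (ε - 1) := by gcongr
      _ = 2 * lam k ^ ε := by
        rw [Real.rpow_sub_one hl.ne']; field_simp
      _ ≤ 2 * lam k ^ (2 * ε) := by
        gcongr
        linarith
  obtain ⟨D, hD⟩ := hbdd
  refine ⟨max D 1, by positivity, fun k => ?_⟩
  have hp : 0 < lam k ^ (2 * ε) := Real.rpow_pos_of_pos (hlam_pos k) _
  rw [← div_le_iff₀ hp]
  have := hD (mem_range_self k)
  rw [hr] at this
  exact this.trans (le_max_left _ _)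

theorem sq_integral_mul_le {t : ℝ} (ht : 0 ≤ t) {m h : ℝ → ℝ} (hm : ∀ x ∈ Icc 0 t, 0 ≤ m x)
    (h₀ : IntervalIntegrable m volume 0 t)
    (h₁ : IntervalIntegrable (fun x => m x * h x) volume 0 t)
    (h₂ : IntervalIntegrable (fun x => m x * h x ^ 2) volume 0 t)
    (hpos : 0 < ∫ x in (0 : ℝ)..t, m x) :
    (∫ x in (0 : ℝ)..t, m x * h x) ^ 2 ≤
      (∫ x in (0 : ℝ)..t, m x) * ∫ x in (0 : ℝ)..t, m x * h x ^ 2 := by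
  set M := ∫ x in (0 : ℝ)..t, m x
  set A := ∫ x in (0 : ℝ)..t, m x * h x
  have hnn : 0 ≤ ∫ x in (0 : ℝ)..t, (m x * h x ^ 2 - 2 * (A / M) * (m x * h x)) +
      (A / M) ^ 2 * m x := by
    refine intervalIntegral.integral_nonneg ht fun x hx => ?_
    have := mul_nonneg (hm x hx) (sq_nonneg (h x - A / M))
    linarith
  rw [intervalIntegral.integral_add (h₂.sub (h₁.const_mul _)) (h₀.const_mul _),
    intervalIntegral.integral_sub h₂ (h₁.const_mul _), intervalIntegral.integral_const_mul,
    intervalIntegral.integral_const_mul] at hnn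
  change 0 ≤ (∫ x in (0 : ℝ)..t, m x * h x ^ 2) - 2 * (A / M) * A + (A / M) ^ 2 * M at hnn
  have e : 2 * (A / M) * A - (A / M) ^ 2 * M = A ^ 2 / M := by
    field_simp; ring
  have hd : A ^ 2 / M ≤ ∫ x in (0 : ℝ)..t, m x * h x ^ 2 := by linarith
  rwa [div_le_iff₀' hpos] at hd

theorem intervalIntegrable_rpow_mul {κ t : ℝ} (hκ : 0 < κ) {f : ℝ → ℝ} (ht : 0 ≤ t)
    (hf : ContinuousOn f (Icc 0 t)) :
    IntervalIntegrable (fun x => x ^ (κ - 1) * f x) volume 0 t :=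
  (intervalIntegral.intervalIntegrable_rpow' (by linarith)).mul_continuousOn
    (by rwa [uIcc_of_le ht])

theorem integral_rpow_sub_one {κ : ℝ} (hκ : 0 < κ) (t : ℝ) :
    ∫ x in (0 : ℝ)..t, x ^ (κ - 1) = t ^ κ / κ := by
  rw [integral_rpow (Or.inl (by linarith)), sub_add_cancel, Real.zero_rpow hκ.ne', sub_zero]

theorem continuousOn_comp_sub {E : Type*} [TopologicalSpace E] {g : ℝ → E} {t T : ℝ}
    (ht : t ∈ Icc 0 T) (hg : ContinuousOn g (Icc 0 T)) :
    ContinuousOn (fun η => g (t - η)) (Icc 0 t) :=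
  hg.comp (by fun_prop) fun η hη => ⟨by linarith [hη.2], by linarith [hη.1, ht.2]⟩

theorem norm_convolution_sq_le {κ B t T : ℝ} (hκ : 0 < κ) (ht : t ∈ Icc 0 T)
    {K g : ℝ → ℂ} (hg : ContinuousOn g (Icc 0 T))
    (hK : ∀ η, 0 < η → ‖K η‖ ≤ B * η ^ (κ - 1)) :
    ‖∫ η in (0 : ℝ)..t, K η * g (t - η)‖ ^ 2 ≤
      B ^ 2 * (t ^ κ / κ * ∫ η in (0 : ℝ)..t, η ^ (κ - 1) * ‖g (t - η)‖ ^ 2) := by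
  rcases ht.1.eq_or_lt with rfl | ht0
  · simp
  have hgc := (continuousOn_comp_sub ht hg).norm
  have i₁ := intervalIntegrable_rpow_mul hκ ht.1 hgc
  have hle : ‖∫ η in (0 : ℝ)..t, K η * g (t - η)‖ ≤
      B * ∫ η in (0 : ℝ)..t, η ^ (κ - 1) * ‖g (t - η)‖ := by
    rw [← intervalIntegral.integral_const_mul]
    refine intervalIntegral.norm_integral_le_of_norm_le ht.1
      (Eventually.of_forall fun η hη => ?_) (i₁.const_mul B)
    rw [norm_mul, ← mul_assoc]
    gcongr
    exact hK η hη.1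
  have hcs := sq_integral_mul_le (m := fun η => η ^ (κ - 1)) (h := fun η => ‖g (t - η)‖) ht.1
    (fun x hx => Real.rpow_nonneg hx.1 _) (intervalIntegral.intervalIntegrable_rpow' (by linarith))
    i₁ (intervalIntegrable_rpow_mul hκ ht.1 (hgc.pow 2))
    (by rw [integral_rpow_sub_one hκ]; positivity)
  rw [integral_rpow_sub_one hκ] at hcs
  calc _ ≤ _ := pow_le_pow_left₀ (norm_nonneg _) hle 2
    _ = B ^ 2 * (∫ η in (0 : ℝ)..t, η ^ (κ - 1) * ‖g (t - η)‖) ^ 2 := mul_pow _ _ _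
    _ ≤ _ := by gcongr

theorem sum_integral_rpow_mul_le {κ S t T : ℝ} (hκ : 0 < κ) (ht : t ∈ Icc 0 T)
    {g : ℕ → ℝ → ℂ} (hg : ∀ k, ContinuousOn (g k) (Icc 0 T)) {c : ℕ → ℝ} {u : Finset ℕ}
    (hS : ∀ s ∈ Icc 0 T, ∑ k ∈ u, c k * ‖g k s‖ ^ 2 ≤ S) :
    ∑ k ∈ u, c k * ∫ η in (0 : ℝ)..t, η ^ (κ - 1) * ‖g k (t - η)‖ ^ 2 ≤ t ^ κ / κ * S := by
  have hi : ∀ k, IntervalIntegrable (fun η => η ^ (κ - 1) * ‖g k (t - η)‖ ^ 2) volume 0 t :=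
    fun k => intervalIntegrable_rpow_mul hκ ht.1 ((continuousOn_comp_sub ht (hg k)).norm.pow 2)
  simp only [← intervalIntegral.integral_const_mul]
  rw [← intervalIntegral.integral_finsetSum fun k _ => (hi k).const_mul (c k),
    ← integral_rpow_sub_one hκ, ← intervalIntegral.integral_mul_const]
  refine intervalIntegral.integral_mono_on ht.1
    (by simpa only [Finset.sum_fn] using
      IntervalIntegrable.sum u fun k _ => (hi k).const_mul (c k))
    ((intervalIntegral.intervalIntegrable_rpow' (by linarith)).mul_const S) fun η hη => ?_
  have hsum : ∑ k ∈ u, c k * (η ^ (κ - 1) * ‖g k (t - η)‖ ^ 2) =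
      η ^ (κ - 1) * ∑ k ∈ u, c k * ‖g k (t - η)‖ ^ 2 := by
    rw [Finset.mul_sum]
    exact Finset.sum_congr rfl fun k _ => by ring
  rw [hsum]
  exact mul_le_mul_of_nonneg_left
    (hS _ ⟨by linarith [hη.2], by linarith [hη.1, ht.2]⟩) (Real.rpow_nonneg hη.1 _)

/-- Estimate for the convolution terms with weight `λₖ²/|α²-λₖ|`
for data in `D(A^ε)`. -/
theorem convolution_estimate_eps
    (ρ T α ε : ℝ) (hρ0 : 0 < ρ) (hρ1 : ρ < 1) (hT : 0 < T) (hα : 0 < α)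
    (hε0 : 0 < ε) (hε1 : ε < 1)
    (lam : ℕ → ℝ) (hlam_pos : ∀ k, 0 < lam k) (hlam_mono : Monotone lam)
    (hlam_tend : Tendsto lam atTop atTop) (hlam_ne : ∀ k, lam k ≠ α ^ 2) :
    ∃ C > (0:ℝ), ∀ g : ℕ → ℝ → ℂ,
      (∀ k, ContinuousOn (g k) (Icc 0 T)) →
      (∀ t ∈ Icc (0:ℝ) T, Summable fun k => lam k ^ (2 * ε) * ‖g k t‖ ^ 2) →
      BddAbove (Set.range fun s : Icc (0:ℝ) T =>
        ∑' k, lam k ^ (2 * ε) * ‖g k (s : ℝ)‖ ^ 2) →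
      ∀ σ : ℂ, (σ = 1 ∨ σ = -1) →
        ∀ t ∈ Icc (0:ℝ) T,
          (∑' k, (lam k ^ 2 / |α ^ 2 - lam k|) *
              ‖∫ η in (0:ℝ)..t, ((η ^ (ρ - 1) : ℝ) : ℂ) *
                mlE ρ ρ (-(((α : ℂ) + σ * sqrtD α (lam k))) * ((η ^ ρ : ℝ) : ℂ)) *
                g k (t - η)‖ ^ 2) ≤
            C * ⨆ s : Icc (0:ℝ) T, ∑' k, lam k ^ (2 * ε) * ‖g k (s : ℝ)‖ ^ 2 := by
  obtain ⟨C, hC0, hC⟩ := exists_norm_mlE_le_s18 hρ0 hρ1 (δ := 1 - ε) (by linarith) (by linarith)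
  obtain ⟨D₁, hD₁0, hD₁⟩ := exists_weight_le (α := α) hε0 hlam_pos hlam_tend (σ := 1) (.inl rfl)
  obtain ⟨D₂, hD₂0, hD₂⟩ := exists_weight_le (α := α) hε0 hlam_pos hlam_tend (σ := -1) (.inr rfl)
  have hκ : 0 < ρ * ε := mul_pos hρ0 hε0
  refine ⟨C ^ 2 * (D₁ + D₂) * (T ^ (ρ * ε) / (ρ * ε)) ^ 2, by positivity, ?_⟩
  intro g hg hsum hbdd σ hσ t ht
  have hD : ∀ k, lam k ^ 2 / |α ^ 2 - lam k| *
      (‖(α : ℂ) + σ * sqrtD α (lam k)‖ ^ (-(1 - ε))) ^ 2 ≤ (D₁ + D₂) * lam k ^ (2 * ε) := by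
    intro k
    have hp := Real.rpow_nonneg (hlam_pos k).le (2 * ε)
    rcases hσ with rfl | rfl
    · exact (hD₁ k).trans (by gcongr; linarith)
    · exact (hD₂ k).trans (by gcongr; linarith)
  set S := ⨆ s : Icc (0:ℝ) T, ∑' k, lam k ^ (2 * ε) * ‖g k (s : ℝ)‖ ^ 2
  have hnn : ∀ s k, 0 ≤ lam k ^ (2 * ε) * ‖g k s‖ ^ 2 := fun s k =>
    mul_nonneg (Real.rpow_nonneg (hlam_pos k).le _) (sq_nonneg _)
  have hS : ∀ u : Finset ℕ, ∀ s ∈ Icc (0:ℝ) T, ∑ k ∈ u, lam k ^ (2 * ε) * ‖g k s‖ ^ 2 ≤ S :=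
    fun u s hs => ((hsum s hs).sum_le_tsum u fun k _ => hnn s k).trans
      (le_ciSup hbdd (⟨s, hs⟩ : Icc (0:ℝ) T))
  have hS0 : 0 ≤ S := by simpa using hS ∅ t ht
  have hterm : ∀ k, (lam k ^ 2 / |α ^ 2 - lam k|) *
      ‖∫ η in (0:ℝ)..t, ((η ^ (ρ - 1) : ℝ) : ℂ) *
        mlE ρ ρ (-(((α : ℂ) + σ * sqrtD α (lam k))) * ((η ^ ρ : ℝ) : ℂ)) * g k (t - η)‖ ^ 2 ≤
      C ^ 2 * (D₁ + D₂) * (t ^ (ρ * ε) / (ρ * ε)) * (lam k ^ (2 * ε) *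
        ∫ η in (0:ℝ)..t, η ^ (ρ * ε - 1) * ‖g k (t - η)‖ ^ 2) := by
    intro k
    have hre := re_add_mul_sqrtD_pos hα (hlam_pos k) hσ
    set z : ℂ := (α : ℂ) + σ * sqrtD α (lam k)
    have hz0 : z ≠ 0 := fun h => by rw [h] at hre; exact lt_irrefl _ hre
    have hK : ∀ η : ℝ, 0 < η → ‖((η ^ (ρ - 1) : ℝ) : ℂ) * mlE ρ ρ (-z * ((η ^ ρ : ℝ) : ℂ))‖ ≤
        C * ‖z‖ ^ (-(1 - ε)) * η ^ (ρ * ε - 1) := by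
      intro η hη
      have hp : 0 < η ^ ρ := Real.rpow_pos_of_pos hη _
      have h := hC (z * ((η ^ ρ : ℝ) : ℂ))
        (by rw [Complex.re_mul_ofReal]; positivity)
        (mul_ne_zero hz0 (by exact_mod_cast hp.ne'))
      rw [norm_mul z, Complex.norm_of_nonneg hp.le, Real.mul_rpow (norm_nonneg _) hp.le,
        ← Real.rpow_mul hη.le] at h
      rw [neg_mul, norm_mul, Complex.norm_of_nonneg (Real.rpow_nonneg hη.le _)]
      have hexp : η ^ (ρ * ε - 1) = η ^ (ρ - 1) * η ^ (ρ * -(1 - ε)) := by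
        rw [← Real.rpow_add hη]; congr 1; ring
      rw [hexp]
      calc _ ≤ η ^ (ρ - 1) * _ := mul_le_mul_of_nonneg_left h (Real.rpow_nonneg hη.le _)
        _ = _ := by ring
    have hconv := norm_convolution_sq_le hκ ht (hg k) hK
    have hI : 0 ≤ t ^ (ρ * ε) / (ρ * ε) *
        ∫ η in (0:ℝ)..t, η ^ (ρ * ε - 1) * ‖g k (t - η)‖ ^ 2 :=
      mul_nonneg (div_nonneg (Real.rpow_nonneg ht.1 _) hκ.le)
        (intervalIntegral.integral_nonneg ht.1 fun η hη =>
          mul_nonneg (Real.rpow_nonneg hη.1 _) (sq_nonneg _))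
    calc _ ≤ _ := mul_le_mul_of_nonneg_left hconv (by positivity)
      _ = C ^ 2 * ((lam k ^ 2 / |α ^ 2 - lam k| * (‖z‖ ^ (-(1 - ε))) ^ 2) *
          (t ^ (ρ * ε) / (ρ * ε) *
            ∫ η in (0:ℝ)..t, η ^ (ρ * ε - 1) * ‖g k (t - η)‖ ^ 2)) := by ring
      _ ≤ C ^ 2 * (((D₁ + D₂) * lam k ^ (2 * ε)) * (t ^ (ρ * ε) / (ρ * ε) *
            ∫ η in (0:ℝ)..t, η ^ (ρ * ε - 1) * ‖g k (t - η)‖ ^ 2)) :=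
          mul_le_mul_of_nonneg_left (mul_le_mul_of_nonneg_right (hD k) hI) (sq_nonneg C)
      _ = _ := by ring
  refine Real.tsum_le_of_sum_le (fun k => by positivity) fun u => ?_
  have ht0 : 0 ≤ t ^ (ρ * ε) / (ρ * ε) := div_nonneg (Real.rpow_nonneg ht.1 _) hκ.le
  have htT : t ^ (ρ * ε) / (ρ * ε) ≤ T ^ (ρ * ε) / (ρ * ε) := by
    have := Real.rpow_le_rpow ht.1 ht.2 hκ.le
    gcongr
  calc _ ≤ _ := Finset.sum_le_sum fun k _ => hterm k
    _ = C ^ 2 * (D₁ + D₂) * (t ^ (ρ * ε) / (ρ * ε)) * ∑ k ∈ u, lam k ^ (2 * ε) *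
        ∫ η in (0:ℝ)..t, η ^ (ρ * ε - 1) * ‖g k (t - η)‖ ^ 2 := (Finset.mul_sum _ _ _).symm
    _ ≤ C ^ 2 * (D₁ + D₂) * (t ^ (ρ * ε) / (ρ * ε)) * (t ^ (ρ * ε) / (ρ * ε) * S) :=
        mul_le_mul_of_nonneg_left (sum_integral_rpow_mul_le hκ ht hg (hS u)) (by positivity)
    _ = C ^ 2 * (D₁ + D₂) * (t ^ (ρ * ε) / (ρ * ε)) ^ 2 * S := by ring
    _ ≤ _ := by gcongr
end
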